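/- arXiv:1907.11632 — 14 statements merged into one kernel-verified Lean document; each statement's English description precedes it below -/
import Mathlib

section
/- For every t ≥ 1, every k, and every s ≥ 2: if x_1,...,x_s and y_1,...,y_s are t-element subsets of {1,...,k} such that x_i ∩ y_j ≠ ∅ if and only if i = j, then s ≤ k - 2t + 2. (That is, the largest identity submatrix of A_{k,t} has size at most k - 2t + 2.) -/
/-- For every `t ≥ 1`, every `k`, and every `s ≥ 2`: if
`x_1, …, x_s` and `y_1, …, y_s` are `t`-element subsets of `{1, …, k}` such
that `x i ∩ y j ≠ ∅` iff `i = j`, then `s ≤ k - 2t + 2`. -/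
theorem identity_submatrix_upper_bound (t k s : ℕ) (ht : 1 ≤ t) (hs : 2 ≤ s)
    (x y : Fin s → Finset ℕ)
    (hx : ∀ i, x i ⊆ Finset.Icc 1 k ∧ (x i).card = t)
    (hy : ∀ i, y i ⊆ Finset.Icc 1 k ∧ (y i).card = t)
    (hiso : ∀ i j, (x i ∩ y j).Nonempty ↔ i = j) :
    (s : ℤ) ≤ (k : ℤ) - 2 * t + 2 := by
  choose p hp using fun i => (hiso i i).2 rfl
  simp only [Finset.mem_inter] at hp
  have eq_of_mem {i j : Fin s} {a : ℕ} (hi : a ∈ x i) (hj : a ∈ y j) : i = j :=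
    (hiso i j).1 ⟨a, Finset.mem_inter.2 ⟨hi, hj⟩⟩
  have hp_inj : Function.Injective p := fun i j h => eq_of_mem (hp i).1 (h ▸ (hp j).2)
  let i₀ : Fin s := ⟨0, by omega⟩
  let i₁ : Fin s := ⟨1, by omega⟩
  have hne : i₀ ≠ i₁ := by simp [i₀, i₁]
  -- `x i₀` and `y i₁` are disjoint, and neither contains `p l` for any other index `l`.
  let L : Finset (Fin s) := Finset.univ \ {i₀, i₁}
  have hL : (L.image p).card = s - 2 := by
    rw [Finset.card_image_of_injective _ hp_inj, Finset.card_sdiff_of_subset (Finset.subset_univ _),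
      Finset.card_pair hne, Finset.card_univ, Fintype.card_fin]
  have hxy : Disjoint (x i₀) (y i₁) :=
    Finset.disjoint_left.2 fun _ h₀ h₁ => hne (eq_of_mem h₀ h₁)
  have hdisj : Disjoint (x i₀ ∪ y i₁) (L.image p) := by
    rw [Finset.disjoint_right]
    intro a ha hmem
    obtain ⟨l, hl, rfl⟩ := Finset.mem_image.1 ha
    simp only [L, Finset.mem_sdiff, Finset.mem_univ, true_and, Finset.mem_insert,
      Finset.mem_singleton, not_or] at hl
    rcases Finset.mem_union.1 hmem with h | h
    · exact hl.1 (eq_of_mem h (hp l).2).symm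
    · exact hl.2 (eq_of_mem (hp l).1 h)
  have hsub : (x i₀ ∪ y i₁) ∪ L.image p ⊆ Finset.Icc 1 k :=
    Finset.union_subset (Finset.union_subset (hx i₀).1 (hy i₁).1)
      (Finset.image_subset_iff.2 fun l _ => (hx l).1 (hp l).1)
  have hcard := Finset.card_le_card hsub
  rw [Finset.card_union_of_disjoint hdisj, Finset.card_union_of_disjoint hxy, (hx i₀).2,
    (hy i₁).2, hL, Nat.card_Icc] at hcard
  omega
end

section
/- Let X be an n × r Boolean matrix and Y an r × n Boolean matrix whose Boolean product XY equals the n × n identity matrix I_n. Denote by x_1,...,x_r the columns of X and by y_1,...,y_r the rows of Y. Then: (1) for each i ∈ [r], either there is some j ∈ [n] with x_i = y_i = e_j (the j-th standard basis vector), or x_i is the all-zeros vector, or y_i is the all-zeros vector; and (2) for each j ∈ [n], there exists some i ∈ [r] such that x_i = y_i = e_j. -/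
/-- if `X` is an `n × r` Boolean matrix and `Y` an `r × n` Boolean
matrix whose Boolean product is the identity matrix `I_n`, then (1) each pair
of a column `x_i` of `X` and row `y_i` of `Y` is either a matching pair of
standard basis vectors, or one of them is all-zeros, and (2) for each `j`,
some pair `x_i = y_i = e_j` occurs. -/
theorem boolean_decomposition_of_identity (n r : ℕ)
    (X : Matrix (Fin n) (Fin r) Bool) (Y : Matrix (Fin r) (Fin n) Bool)
    (hXY : ∀ i j : Fin n, (∃ l : Fin r, X i l = true ∧ Y l j = true) ↔ i = j) :
    (∀ i : Fin r,
        (∃ j : Fin n, (∀ p : Fin n, X p i = decide (p = j)) ∧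
                      (∀ p : Fin n, Y i p = decide (p = j))) ∨
        (∀ p : Fin n, X p i = false) ∨ (∀ p : Fin n, Y i p = false)) ∧
    (∀ j : Fin n, ∃ i : Fin r,
        (∀ p : Fin n, X p i = decide (p = j)) ∧
        (∀ p : Fin n, Y i p = decide (p = j))) := by
  have heq : ∀ {l : Fin r} {a b : Fin n}, X a l = true → Y l b = true → a = b :=
    fun ha hb => (hXY _ _).1 ⟨_, ha, hb⟩
  have basis : ∀ {l : Fin r} {j : Fin n}, X j l = true → Y l j = true →
      (∀ p : Fin n, X p l = decide (p = j)) ∧ (∀ p : Fin n, Y l p = decide (p = j)) := by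
    intro l j hX hY
    refine ⟨fun p => ?_, fun p => ?_⟩ <;> rw [Bool.eq_iff_iff, decide_eq_true_iff]
    · exact ⟨fun hp => heq hp hY, fun hp => hp ▸ hX⟩
    · exact ⟨fun hp => (heq hX hp).symm, fun hp => hp ▸ hY⟩
  refine ⟨fun i => ?_, fun j => ?_⟩
  · by_cases hX : ∀ p, X p i = false
    · exact .inr (.inl hX)
    by_cases hY : ∀ p, Y i p = false
    · exact .inr (.inr hY)
    simp only [not_forall, Bool.not_eq_false] at hX hY
    obtain ⟨a, ha⟩ := hX
    obtain ⟨b, hb⟩ := hY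
    obtain rfl := heq ha hb
    exact .inl ⟨a, basis ha hb⟩
  · obtain ⟨l, hX, hY⟩ := (hXY j j).2 rfl
    exact ⟨l, basis hX hY⟩
end

section
/- Let n ≥ 2, let X be an n × r Boolean matrix and Y an r × n Boolean matrix whose Boolean product XY equals the n × n identity matrix I_n. Then the total number of 1 entries in X and Y together is at most 2n + (r - n)·n. -/
open Finset

/-- if `n ≥ 2`, `X` is an `n × r` Boolean matrix and `Y` an
`r × n` Boolean matrix whose Boolean product is the identity matrix `I_n`,
then the total number of `1` entries in `X` and `Y` together is at most
`2n + (r - n)·n`. -/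
theorem ones_bound_boolean_decomposition_of_identity (n r : ℕ) (hn : 2 ≤ n)
    (X : Matrix (Fin n) (Fin r) Bool) (Y : Matrix (Fin r) (Fin n) Bool)
    (hXY : ∀ i j : Fin n, (∃ l : Fin r, X i l = true ∧ Y l j = true) ↔ i = j) :
    ((univ.filter (fun p : Fin n × Fin r => X p.1 p.2 = true)).card : ℤ) +
      ((univ.filter (fun p : Fin r × Fin n => Y p.1 p.2 = true)).card : ℤ) ≤
      2 * n + ((r : ℤ) - n) * n := by
  choose f hfX hfY using fun i => (hXY i i).2 rfl
  have hf : Function.Injective f := fun i j h =>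
    (hXY i j).1 ⟨f i, hfX i, h ▸ hfY j⟩
  let A : Fin r → Finset (Fin n) := fun l => univ.filter fun i => X i l = true
  let B : Fin r → Finset (Fin n) := fun l => univ.filter fun j => Y l j = true
  have hAB : ∀ l, ∀ i ∈ A l, ∀ j ∈ B l, i = j := fun l i hi j hj =>
    (hXY i j).1 ⟨l, (mem_filter.1 hi).2, (mem_filter.1 hj).2⟩
  have hX : (univ.filter (fun p : Fin n × Fin r => X p.1 p.2 = true)).card =
      ∑ l, (A l).card := by
    simp only [A, card_filter, Fintype.sum_prod_type_right]
  have hY : (univ.filter (fun p : Fin r × Fin n => Y p.1 p.2 = true)).card =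
      ∑ l, (B l).card := by
    simp only [B, card_filter, Fintype.sum_prod_type]
  have htwo : ∀ l, (A l).Nonempty → (B l).Nonempty → (A l).card + (B l).card ≤ 2 := by
    rintro l ⟨i, hi⟩ ⟨j, hj⟩
    have hA : (A l).card ≤ 1 := card_le_one.2 fun a ha b hb =>
      (hAB l a ha j hj).trans (hAB l b hb j hj).symm
    have hB : (B l).card ≤ 1 := card_le_one.2 fun a ha b hb =>
      (hAB l i hi a ha).symm.trans (hAB l i hi b hb)
    omega
  have hle : ∀ l, (A l).card + (B l).card ≤ n := by
    intro l
    rcases (A l).eq_empty_or_nonempty with hA | hA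
    · simpa [hA] using card_le_univ (B l)
    · rcases (B l).eq_empty_or_nonempty with hB | hB
      · simpa [hB] using card_le_univ (A l)
      · exact (htwo l hA hB).trans hn
  have himage : (univ.image f).card = n := by
    rw [card_image_of_injective _ hf, card_univ, Fintype.card_fin]
  have hin : ∑ l ∈ univ.image f, ((A l).card + (B l).card) ≤ n * 2 := by
    refine (sum_le_card_nsmul _ _ 2 fun l hl => ?_).trans_eq (by rw [himage, smul_eq_mul])
    obtain ⟨i, -, rfl⟩ := mem_image.1 hl
    exact htwo _ ⟨i, by simp [A, hfX]⟩ ⟨i, by simp [B, hfY]⟩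
  have hout : ∑ l ∈ (univ.image f)ᶜ, ((A l).card + (B l).card) ≤ (r - n) * n :=
    (sum_le_card_nsmul _ _ n fun l _ => hle l).trans_eq (by
      rw [card_compl, himage, Fintype.card_fin, smul_eq_mul])
  have hnr : n ≤ r := by simpa using Fintype.card_le_of_injective f hf
  have htotal : ∑ l, (A l).card + ∑ l, (B l).card ≤ n * 2 + (r - n) * n := by
    rw [← sum_add_distrib, ← sum_add_sum_compl (univ.image f)]
    exact Nat.add_le_add hin hout
  rw [hX, hY]
  zify [hnr] at htotal
  push_cast
  linarith
end

section
/- Let a, b ≥ 2. If there exists a triangular family of size m₁ with parameters (a, b-1) and a triangular family of size m₂ with parameters (a-1, b), then there exists a triangular family of size m₁ + m₂ + 1 with parameters (a, b). (In the paper's notation, f(a,b) ≥ f(a,b-1) + f(a-1,b) + 1, where f(a,b) is the maximal size of a triangular family with parameters (a,b).) -/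
/-- The embedding `n ↦ 3 * n + r` of `ℕ` into the residue class of `r` modulo `3`. -/
def residueEmbedding (r : ℕ) : ℕ ↪ ℕ := ⟨fun n => 3 * n + r, fun x y h => by simpa using h⟩

theorem mod_three_of_mem_map {r : ℕ} {S : Finset ℕ} {x : ℕ}
    (h : x ∈ S.map (residueEmbedding r)) : x % 3 = r % 3 := by
  obtain ⟨n, -, rfl⟩ := Finset.mem_map.1 h
  exact Nat.mul_add_mod 3 n r

theorem zero_mem_map_range {n : ℕ} (hn : 0 < n) :
    0 ∈ (Finset.range n).map (residueEmbedding 0) :=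
  Finset.mem_map.2 ⟨0, Finset.mem_range.2 hn, rfl⟩

theorem zero_notMem_map {r : ℕ} (hr : r % 3 ≠ 0) (S : Finset ℕ) :
    0 ∉ S.map (residueEmbedding r) :=
  fun h => hr (mod_three_of_mem_map h).symm

theorem not_nonempty_map_inter_map {r s : ℕ} (h : r % 3 ≠ s % 3) (S T : Finset ℕ) :
    ¬ (S.map (residueEmbedding r) ∩ T.map (residueEmbedding s)).Nonempty := by
  rintro ⟨x, hx⟩
  rw [Finset.mem_inter] at hx
  exact h ((mod_three_of_mem_map hx.1).symm.trans (mod_three_of_mem_map hx.2))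

theorem nonempty_map_inter_map (r : ℕ) (S T : Finset ℕ) :
    (S.map (residueEmbedding r) ∩ T.map (residueEmbedding r)).Nonempty ↔ (S ∩ T).Nonempty := by
  rw [← Finset.map_inter, Finset.map_nonempty]

theorem nonempty_inter_of_mem {x : ℕ} {S T : Finset ℕ} (hS : x ∈ S) (hT : x ∈ T) :
    (S ∩ T).Nonempty :=
  ⟨x, Finset.mem_inter.2 ⟨hS, hT⟩⟩

theorem nonempty_inter_insert {x : ℕ} {S T : Finset ℕ} (h : x ∉ S) :
    (S ∩ insert x T).Nonempty ↔ (S ∩ T).Nonempty := by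
  rw [Finset.inter_insert_of_notMem h]

theorem nonempty_insert_inter {x : ℕ} {S T : Finset ℕ} (h : x ∉ T) :
    (insert x S ∩ T).Nonempty ↔ (S ∩ T).Nonempty := by
  rw [Finset.insert_inter_of_notMem h]

/-- for `a, b ≥ 2`, if there is a triangular family of size `m₁`
with parameters `(a, b-1)` and a triangular family of size `m₂` with
parameters `(a-1, b)`, then there is a triangular family of size `m₁ + m₂ + 1`
with parameters `(a, b)`. -/
theorem triangular_family_recursion (a b m₁ m₂ : ℕ) (ha : 2 ≤ a) (hb : 2 ≤ b)
    (h₁ : ∃ A B : Fin m₁ → Finset ℕ,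
      (∀ i, (A i).card = a) ∧ (∀ i, (B i).card = b - 1) ∧
      (∀ i j, (A i ∩ B j).Nonempty ↔ j ≤ i))
    (h₂ : ∃ A B : Fin m₂ → Finset ℕ,
      (∀ i, (A i).card = a - 1) ∧ (∀ i, (B i).card = b) ∧
      (∀ i j, (A i ∩ B j).Nonempty ↔ j ≤ i)) :
    ∃ A B : Fin (m₁ + m₂ + 1) → Finset ℕ,
      (∀ i, (A i).card = a) ∧ (∀ i, (B i).card = b) ∧
      (∀ i j, (A i ∩ B j).Nonempty ↔ j ≤ i) := by
  obtain ⟨A₁, B₁, hA₁, hB₁, h₁⟩ := h₁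
  obtain ⟨A₂, B₂, hA₂, hB₂, h₂⟩ := h₂
  have z₁ := zero_notMem_map (r := 1) (by decide)
  have z₂ := zero_notMem_map (r := 2) (by decide)
  have ha₀ := zero_mem_map_range (n := a) (by omega)
  have hb₀ := zero_mem_map_range (n := b) (by omega)
  refine ⟨fun i =>
      if h : i.val < m₁ then (A₁ ⟨i, h⟩).map (residueEmbedding 1)
      else if h' : i.val = m₁ then (Finset.range a).map (residueEmbedding 0)
      else insert 0 ((A₂ ⟨i - m₁ - 1, by omega⟩).map (residueEmbedding 2)),
    fun i =>
      if h : i.val < m₁ then insert 0 ((B₁ ⟨i, h⟩).map (residueEmbedding 1))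
      else if h' : i.val = m₁ then (Finset.range b).map (residueEmbedding 0)
      else (B₂ ⟨i - m₁ - 1, by omega⟩).map (residueEmbedding 2), ?_, ?_, ?_⟩
  · intro i
    dsimp only
    split_ifs
    · simp [hA₁]
    · simp
    · rw [Finset.card_insert_of_notMem (z₂ _), Finset.card_map, hA₂]
      omega
  · intro i
    dsimp only
    split_ifs
    · rw [Finset.card_insert_of_notMem (z₁ _), Finset.card_map, hB₁]
      omega
    · simp
    · simp [hB₂]
  · intro i j
    rw [Fin.le_def]
    dsimp only
    split_ifs with hi hj hj' hi' hj hj' hj hj'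
    · rw [nonempty_inter_insert (z₁ _), nonempty_map_inter_map, h₁, Fin.mk_le_mk]
    · exact iff_of_false (not_nonempty_map_inter_map (by decide) _ _) (by omega)
    · exact iff_of_false (not_nonempty_map_inter_map (by decide) _ _) (by omega)
    · exact iff_of_true (nonempty_inter_of_mem ha₀ (Finset.mem_insert_self _ _)) (by omega)
    · exact iff_of_true (nonempty_inter_of_mem ha₀ hb₀) (by omega)
    · exact iff_of_false (not_nonempty_map_inter_map (by decide) _ _) (by omega)
    · exact iff_of_true (nonempty_inter_of_mem (Finset.mem_insert_self _ _)
        (Finset.mem_insert_self _ _)) (by omega)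
    · exact iff_of_true (nonempty_inter_of_mem (Finset.mem_insert_self _ _) hb₀) (by omega)
    · rw [nonempty_insert_inter (z₂ _), nonempty_map_inter_map, h₂, Fin.mk_le_mk]
      omega
end

section
/- For all a, b ≥ 1, there exists a triangular family of size binom(a+b, a) - 1 with parameters (a,b): that is, there exist finite sets A_1,...,A_m and B_1,...,B_m with m = binom(a+b,a) - 1, |A_i| = a and |B_i| = b for all i, and A_i ∩ B_j ≠ ∅ if and only if i ≥ j. -/
/-- The first `m` pairs `(A i, B i)` form a triangular family with parameters `(a, b)`. -/
def IsTriangularFamily (a b m : ℕ) (A B : ℕ → Finset ℕ) : Prop :=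
  (∀ i < m, (A i).card = a) ∧ (∀ i < m, (B i).card = b) ∧
    ∀ i < m, ∀ j < m, (∃ x, x ∈ A i ∧ x ∈ B j) ↔ j ≤ i

/-- The sets in position `i` of the concatenation of a family `S` of length `m`, a single set `M`
and a family `T`. -/
def concatFamily (m : ℕ) (S : ℕ → Finset ℕ) (M : Finset ℕ) (T : ℕ → Finset ℕ) (i : ℕ) :
    Finset ℕ :=
  if i < m then S i else if i = m then M else T (i - m - 1)

/-- Triangular families with parameters `(a + 1, b)` and `(a, b + 1)` combine, on disjoint ground
sets and with one extra pair in the middle, to one with parameters `(a + 1, b + 1)`. -/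
theorem IsTriangularFamily.combine {a b m n : ℕ} {A B A' B' : ℕ → Finset ℕ}
    (h : IsTriangularFamily (a + 1) b m A B) (h' : IsTriangularFamily a (b + 1) n A' B') :
    ∃ C D, IsTriangularFamily (a + 1) (b + 1) (m + n + 1) C D := by
  obtain ⟨hA, hB, hAB⟩ := h
  obtain ⟨hA', hB', hAB'⟩ := h'
  have inj (r : ℕ) : Function.Injective (fun x : ℕ => 3 * x + r) := fun x y hxy => by
    simp only at hxy; omega
  refine ⟨concatFamily m (fun i => (A i).image (3 * · + 1))
      ((Finset.range (a + 1)).image (3 * · + 0))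
      (fun i => insert 0 ((A' i).image (3 * · + 2))),
    concatFamily m (fun i => insert 0 ((B i).image (3 * · + 1)))
      ((Finset.range (b + 1)).image (3 * · + 0))
      (fun i => (B' i).image (3 * · + 2)), ?_, ?_, ?_⟩
  · intro i hi
    unfold concatFamily
    split_ifs with h1 h2
    · rw [Finset.card_image_of_injective _ (inj 1), hA i h1]
    · rw [Finset.card_image_of_injective _ (inj 0), Finset.card_range]
    · rw [Finset.card_insert_of_notMem (by simp),
        Finset.card_image_of_injective _ (inj 2), hA' _ (by omega)]
  · intro i hi
    unfold concatFamily
    split_ifs with h1 h2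
    · rw [Finset.card_insert_of_notMem (by simp),
        Finset.card_image_of_injective _ (inj 1), hB i h1]
    · rw [Finset.card_image_of_injective _ (inj 0), Finset.card_range]
    · rw [Finset.card_image_of_injective _ (inj 2), hB' _ (by omega)]
  · intro i hi j hj
    unfold concatFamily
    split_ifs with h1 h2 h3 h4 h5 h6 h7 h8
    · rw [← hAB i h1 j h2]
      constructor
      · rintro ⟨x, hx, hy⟩
        simp only [Finset.mem_image, Finset.mem_insert] at hx hy
        obtain ⟨u, hu, rfl⟩ := hx
        obtain hy | ⟨v, hv, hvu⟩ := hy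
        · omega
        · obtain rfl : v = u := by omega
          exact ⟨v, hu, hv⟩
      · rintro ⟨x, hx, hy⟩
        exact ⟨3 * x + 1, Finset.mem_image_of_mem _ hx,
          Finset.mem_insert_of_mem (Finset.mem_image_of_mem _ hy)⟩
    · refine iff_of_false ?_ (by omega)
      rintro ⟨x, hx, hy⟩
      simp only [Finset.mem_image] at hx hy
      omega
    · refine iff_of_false ?_ (by omega)
      rintro ⟨x, hx, hy⟩
      simp only [Finset.mem_image] at hx hy
      omega
    · exact iff_of_true ⟨0, by simp, by simp⟩ (by omega)
    · exact iff_of_true ⟨0, by simp, by simp⟩ (by omega)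
    · refine iff_of_false ?_ (by omega)
      rintro ⟨x, hx, hy⟩
      simp only [Finset.mem_image] at hx hy
      omega
    · exact iff_of_true ⟨0, by simp, by simp⟩ (by omega)
    · exact iff_of_true ⟨0, by simp, by simp⟩ (by omega)
    · rw [show j ≤ i ↔ j - m - 1 ≤ i - m - 1 by omega,
        ← hAB' (i - m - 1) (by omega) (j - m - 1) (by omega)]
      constructor
      · rintro ⟨x, hx, hy⟩
        simp only [Finset.mem_image, Finset.mem_insert] at hx hy
        obtain ⟨u, hu, rfl⟩ := hy
        obtain hx | ⟨v, hv, hvu⟩ := hx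
        · omega
        · obtain rfl : v = u := by omega
          exact ⟨v, hv, hu⟩
      · rintro ⟨x, hx, hy⟩
        exact ⟨3 * x + 2, Finset.mem_insert_of_mem (Finset.mem_image_of_mem _ hx),
          Finset.mem_image_of_mem _ hy⟩

theorem exists_isTriangularFamily (a b : ℕ) :
    ∃ A B, IsTriangularFamily a b ((a + b).choose a - 1) A B := by
  induction a generalizing b with
  | zero => exact ⟨fun _ => ∅, fun _ => ∅, by simp [IsTriangularFamily]⟩
  | succ a iha =>
    induction b with
    | zero => exact ⟨fun _ => ∅, fun _ => ∅, by simp [IsTriangularFamily]⟩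
    | succ b ihb =>
      obtain ⟨A, B, h⟩ := ihb
      obtain ⟨A', B', hnext⟩ := iha (b + 1)
      have hsize : (a + 1 + (b + 1)).choose (a + 1) - 1 =
          ((a + 1 + b).choose (a + 1) - 1) + ((a + (b + 1)).choose a - 1) + 1 := by
        have h1 : 0 < (a + 1 + b).choose (a + 1) := Nat.choose_pos (by omega)
        have h2 : 0 < (a + (b + 1)).choose a := Nat.choose_pos (by omega)
        have h3 : (a + 1 + (b + 1)).choose (a + 1) =
            (a + (b + 1)).choose a + (a + 1 + b).choose (a + 1) := by
          rw [show a + 1 + (b + 1) = (a + (b + 1)) + 1 by omega, Nat.choose_succ_succ',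
            show a + 1 + b = a + (b + 1) by omega]
        omega
      rw [hsize]
      exact h.combine hnext

/-- for all `a, b ≥ 1`, there is a triangular family of size
`binom(a+b, a) - 1` with parameters `(a, b)`. -/
theorem triangular_family_lower_bound (a b : ℕ) (ha : 1 ≤ a) (hb : 1 ≤ b) :
    ∃ A B : Fin (Nat.choose (a + b) a - 1) → Finset ℕ,
      (∀ i, (A i).card = a) ∧ (∀ i, (B i).card = b) ∧
      (∀ i j, (A i ∩ B j).Nonempty ↔ j ≤ i) := by
  obtain ⟨A, B, hA, hB, hAB⟩ := exists_isTriangularFamily a b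
  refine ⟨fun i => A i, fun i => B i, fun i => hA i i.2, fun i => hB i i.2, fun i j => ?_⟩
  simpa only [Finset.Nonempty, Finset.mem_inter, Fin.le_def] using hAB i i.2 j j.2
end

section
/- For every t ≥ 1, every triangular family with parameters (t,t) has size at most binom(2t, t) - 1: that is, if A_1,...,A_m and B_1,...,B_m are finite sets with |A_i| = |B_i| = t for all i and A_i ∩ B_j ≠ ∅ if and only if i ≥ j, then m ≤ binom(2t,t) - 1. -/
open Finset in
/-- A product of `b` values of a sum of `n` terms expands as a sum over multisets of size `b`. -/
theorem prod_sum_mul_eq_sum_sym {R : Type*} [CommSemiring R] {n b : ℕ}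
    (c : Fin n → R) (z : Fin b → Fin n → R) :
    ∏ k, ∑ l, c l * z k l =
      ∑ s : Sym (Fin n) b, ((s : Multiset (Fin n)).map c).prod *
        ∑ φ : Fin b → Fin n with univ.val.map φ = (s : Multiset (Fin n)), ∏ k, z k (φ k) := by
  rw [Fintype.prod_sum, ← sum_fiberwise univ
    (fun φ : Fin b → Fin n ↦ (Sym.mk (univ.val.map φ) (by simp) : Sym (Fin n) b))]
  refine sum_congr rfl fun s _ ↦ ?_
  rw [mul_sum]
  refine sum_congr (filter_congr fun φ _ ↦ Subtype.ext_iff) fun φ hφ ↦ ?_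
  rw [← (mem_filter.1 hφ).2, Multiset.map_map, prod_mul_distrib]
  rfl

open Finset Polynomial in
/-- **Frankl's skew version of Bollobás's theorem**, for finite subsets of a field. -/
theorem card_le_choose_of_skew_disjoint {ι K : Type*} [Fintype ι] [LinearOrder ι] [Field K]
    {a b : ℕ} (A B : ι → Finset K) (hA : ∀ i, #(A i) = a) (hB : ∀ i, #(B i) = b)
    (hdisj : ∀ i, Disjoint (A i) (B i)) (hmeet : ∀ i j, j < i → ¬ Disjoint (A i) (B j)) :
    Fintype.card ι ≤ (a + b).choose a := by
  let p : ι → K[X] := fun i ↦ ∏ x ∈ A i, (X - C x)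
  have hp i y : (p i).eval y = ∏ x ∈ A i, (y - x) := by simp [p, eval_prod]
  have hdeg i : (p i).natDegree < a + 1 := by simp [p, hA]
  let e : ∀ j, Fin b ≃ B j := fun j ↦ ((B j).equivFinOfCardEq (hB j)).symm
  let M : Matrix ι ι K := .of fun i j ↦ ∏ y ∈ B j, (p i).eval y
  let P : Matrix ι (Sym (Fin (a + 1)) b) K := .of fun i s ↦
    ((s : Multiset (Fin (a + 1))).map fun l : Fin (a + 1) ↦ (p i).coeff l).prod
  let Q : Matrix (Sym (Fin (a + 1)) b) ι K := .of fun s j ↦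
    ∑ φ : Fin b → Fin (a + 1) with univ.val.map φ = (s : Multiset (Fin (a + 1))),
      ∏ k, (e j k : K) ^ (φ k : ℕ)
  have hM : M = P * Q := by
    ext i j
    calc ∏ y ∈ B j, (p i).eval y = ∏ k, (p i).eval (e j k : K) := by
          rw [← prod_coe_sort, ← (e j).prod_comp]
      _ = ∏ k, ∑ l : Fin (a + 1), (p i).coeff l * (e j k : K) ^ (l : ℕ) := by
          refine prod_congr rfl fun k _ ↦ ?_
          rw [eval_eq_sum_range' (hdeg i), sum_range]
      _ = _ := prod_sum_mul_eq_sum_sym (fun l ↦ (p i).coeff l) fun k l ↦ (e j k : K) ^ (l : ℕ)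
  have hdet : M.det ≠ 0 := by
    rw [Matrix.det_of_isUpperTriangular]
    · simp only [M, Matrix.of_apply, hp, prod_ne_zero_iff, sub_ne_zero]
      exact fun i _ y hy x hx ↦ (disjoint_left.1 (hdisj i) hx <| · ▸ hy)
    · intro i j hij
      obtain ⟨x, hxA, hxB⟩ := not_disjoint_iff.1 (hmeet i j hij)
      exact prod_eq_zero hxB <| by rw [hp]; exact prod_eq_zero hxA (sub_self x)
  calc Fintype.card ι = M.rank :=
        (Matrix.rank_of_isUnit M <| (Matrix.isUnit_iff_isUnit_det M).2 hdet.isUnit).symm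
    _ ≤ P.rank := hM ▸ Matrix.rank_mul_le_left P Q
    _ ≤ Fintype.card (Sym (Fin (a + 1)) b) := P.rank_le_card_width
    _ = (a + b).choose a := by
        rw [Sym.card_sym_eq_choose, Fintype.card_fin, Nat.add_right_comm, Nat.add_sub_cancel,
          Nat.choose_symm_add]

theorem Finset.exists_disjoint_card_eq {α : Type*} [Infinite α] (s : Finset α) (n : ℕ) :
    ∃ u : Finset α, Disjoint s u ∧ u.card = n := by
  obtain ⟨u, hu, hn⟩ := s.finite_toSet.infinite_compl.exists_subset_card_eq n
  exact ⟨u, Finset.disjoint_right.2 fun x hx ↦ hu hx, hn⟩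

/-- for every `t ≥ 1`, every triangular family with parameters
`(t, t)` has size at most `binom(2t, t) - 1`. -/
theorem triangular_family_upper_bound (t m : ℕ) (ht : 1 ≤ t)
    (A B : Fin m → Finset ℕ)
    (hA : ∀ i, (A i).card = t) (hB : ∀ i, (B i).card = t)
    (htri : ∀ i j, (A i ∩ B j).Nonempty ↔ j ≤ i) :
    m ≤ Nat.choose (2 * t) t - 1 := by
  have hdisj i j : Disjoint (A i) (B j) ↔ i < j := by
    rw [← not_iff_not, Finset.not_disjoint_iff_nonempty_inter, htri, not_lt]
  obtain ⟨B₁, hAB₁, hB₁⟩ := (Finset.univ.biUnion A).exists_disjoint_card_eq t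
  rw [Finset.disjoint_biUnion_left] at hAB₁
  let B' : Fin (m + 1) → Finset ℕ := Fin.snoc B B₁
  obtain ⟨A₀, hA₀B, hA₀⟩ := (B' 0).exists_disjoint_card_eq t
  let A' : Fin (m + 1) → Finset ℕ := Fin.cons A₀ A
  have hA' i : (A' i).card = t := by
    cases i using Fin.cases <;> simp [A', hA₀, hA]
  have hB' i : (B' i).card = t := by
    cases i using Fin.lastCases <;> simp [B', hB₁, hB]
  have hdisj' i : Disjoint (A' i) (B' i) := by
    cases i using Fin.cases with
    | zero => exact hA₀B.symm
    | succ i =>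
      have hi : A' i.succ = A i := Fin.cons_succ ..
      rw [hi]
      rcases Fin.eq_castSucc_or_eq_last i.succ with ⟨j, hj⟩ | hj
      · rw [hj, show B' j.castSucc = B j from Fin.snoc_castSucc .., hdisj, Fin.lt_def]
        have := congrArg Fin.val hj
        simp only [Fin.val_succ, Fin.val_castSucc] at this
        omega
      · rw [hj, show B' (Fin.last m) = B₁ from Fin.snoc_last ..]
        exact hAB₁ i (Finset.mem_univ i)
  have hmeet' i j (hji : j < i) : ¬ Disjoint (A' i) (B' j) := by
    cases i using Fin.cases with
    | zero => exact absurd hji (Fin.not_lt_zero j)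
    | succ i =>
      cases j using Fin.lastCases with
      | last => exact absurd hji (Fin.le_last _).not_gt
      | cast j =>
        rw [show A' i.succ = A i from Fin.cons_succ ..,
          show B' j.castSucc = B j from Fin.snoc_castSucc .., hdisj, not_lt]
        exact Fin.castSucc_lt_succ_iff.1 hji
  have hcard := card_le_choose_of_skew_disjoint (K := ℚ)
    (fun i ↦ (A' i).map Nat.castEmbedding) (fun i ↦ (B' i).map Nat.castEmbedding)
    (fun i ↦ (Finset.card_map _).trans (hA' i)) (fun i ↦ (Finset.card_map _).trans (hB' i))
    (fun i ↦ (Finset.disjoint_map _).2 (hdisj' i))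
    (fun i j hji ↦ mt (Finset.disjoint_map _).1 (hmeet' i j hji))
  rw [Fintype.card_fin, ← two_mul] at hcard
  exact Nat.le_sub_one_of_lt hcard
end

section
/- For every t ≥ 1 there exists K such that for every k ≥ K, the maximal triangular submatrix of A_{k,t} has size exactly binom(2t,t) - 1: there exist sequences x_1,...,x_d and y_1,...,y_d of t-element subsets of {1,...,k} with d = binom(2t,t) - 1 such that x_i ∩ y_j ≠ ∅ if and only if i ≥ j, and moreover every such pair of sequences (of any length m) satisfies m ≤ binom(2t,t) - 1. -/
open Finset in
/-- A product of `Fintype.card ι` linear forms on `Fin n → ℚ` is a linear combination of the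
monomials of degree `Fintype.card ι`. -/
theorem prod_linear_mem_span_monomials {ι : Type*} [Fintype ι] {n b : ℕ}
    (hb : Fintype.card ι = b) (v : ι → Fin n → ℚ) :
    (fun c : Fin n → ℚ => ∏ i, ∑ j, v i j * c j) ∈ Submodule.span ℚ
      (Set.range fun (s : Sym (Fin n) b) (c : Fin n → ℚ) => (s.1.map c).prod) := by
  classical
  have expand : (fun c : Fin n → ℚ => ∏ i, ∑ j, v i j * c j) =
      ∑ p : ι → Fin n, (∏ i, v i (p i)) • fun c : Fin n → ℚ => ∏ i, c (p i) := by
    funext c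
    simp [Finset.prod_univ_sum, Finset.prod_mul_distrib]
  rw [expand]
  refine Submodule.sum_mem _ fun p _ => Submodule.smul_mem _ _ (Submodule.subset_span ?_)
  refine ⟨⟨univ.val.map p, by simpa using hb⟩, ?_⟩
  funext c
  simp only [Multiset.map_map]
  rfl

/-- The skew Bollobás set-pair inequality for uniform families. -/
theorem skew_bollobas {m a b : ℕ} (A B : Fin m → Finset ℕ)
    (hA : ∀ i, (A i).card = a) (hB : ∀ i, (B i).card = b)
    (diag : ∀ i, Disjoint (A i) (B i))
    (below : ∀ i j, j < i → (A i ∩ B j).Nonempty) : m ≤ (a + b).choose b := by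
  classical
  let P (i : Fin m) : Polynomial ℚ := ∏ s ∈ A i, (Polynomial.X - Polynomial.C (s : ℚ))
  let w (i : Fin m) (j : Fin (a + 1)) : ℚ := (P i).coeff j
  have eval_P (i : Fin m) (e : ℚ) : ∑ j : Fin (a + 1), e ^ (j : ℕ) * w i j
      = ∏ s ∈ A i, (e - s) := by
    have hdeg : (P i).natDegree < a + 1 := by
      simp only [P]
      rw [Polynomial.natDegree_finsetProd_X_sub_C_eq_card, hA]
      omega
    have h := Polynomial.eval_eq_sum_range' hdeg e
    rw [Finset.sum_range] at h
    simp only [P, Polynomial.eval_prod, Polynomial.eval_sub, Polynomial.eval_X,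
      Polynomial.eval_C] at h
    rw [h]
    exact Finset.sum_congr rfl fun j _ => mul_comm _ _
  have coeffs (j : Fin m) : ∃ d : Sym (Fin (a + 1)) b → ℚ,
      ∀ c : Fin (a + 1) → ℚ, ∑ s, d s * (s.1.map c).prod
        = ∏ e : B j, ∑ l : Fin (a + 1), ((e : ℕ) : ℚ) ^ (l : ℕ) * c l := by
    obtain ⟨d, hd⟩ := (Submodule.mem_span_range_iff_exists_fun ℚ).1
      (prod_linear_mem_span_monomials (b := b) (by simpa using hB j)
        fun (e : B j) (l : Fin (a + 1)) => ((e : ℕ) : ℚ) ^ (l : ℕ))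
    refine ⟨d, fun c => ?_⟩
    simpa using congrFun hd c
  choose d hd using coeffs
  let L : Matrix (Fin m) (Sym (Fin (a + 1)) b) ℚ := Matrix.of fun i s => (s.1.map (w i)).prod
  let R : Matrix (Sym (Fin (a + 1)) b) (Fin m) ℚ := Matrix.of fun s j => d j s
  have entry (i j : Fin m) : (L * R) i j = ∏ e : B j, ∏ s ∈ A i, (((e : ℕ) : ℚ) - s) := by
    simp_rw [← eval_P, ← hd, Matrix.mul_apply, L, R, Matrix.of_apply, mul_comm]
  have upper : (L * R).BlockTriangular id := by
    intro i j hji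
    obtain ⟨e, he⟩ := below i j hji
    rw [Finset.mem_inter] at he
    rw [entry]
    exact Finset.prod_eq_zero (Finset.mem_univ ⟨e, he.2⟩)
      (Finset.prod_eq_zero he.1 (sub_self _))
  have hdet : (L * R).det ≠ 0 := by
    rw [Matrix.det_of_isUpperTriangular upper]
    refine Finset.prod_ne_zero_iff.2 fun i _ => ?_
    rw [entry]
    refine Finset.prod_ne_zero_iff.2 fun e _ => Finset.prod_ne_zero_iff.2 fun s hs => ?_
    rw [sub_ne_zero, Ne, Nat.cast_inj]
    intro hes
    exact Finset.disjoint_left.1 (diag i) hs (hes ▸ e.2)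
  have hrank : (L * R).rank = m := by
    simpa using Matrix.rank_of_isUnit _ ((Matrix.isUnit_iff_isUnit_det _).2 hdet.isUnit)
  calc m = (L * R).rank := hrank.symm
    _ ≤ L.rank := Matrix.rank_mul_le_left _ _
    _ ≤ Fintype.card (Sym (Fin (a + 1)) b) := Matrix.rank_le_card_width _
    _ = (a + b).choose b := by
      rw [Sym.card_sym_eq_choose, Fintype.card_fin]
      congr 1
      omega

theorem card_triangular_lt_choose {m k t : ℕ} (x y : Fin m → Finset ℕ)
    (hx : ∀ i, x i ⊆ Finset.Icc 1 k ∧ (x i).card = t)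
    (hy : ∀ i, y i ⊆ Finset.Icc 1 k ∧ (y i).card = t)
    (h : ∀ i j, (x i ∩ y j).Nonempty ↔ j ≤ i) : m + 1 ≤ (2 * t).choose t := by
  rw [two_mul]
  refine skew_bollobas (Fin.cons (α := fun _ => Finset ℕ) (Finset.Ioc k (k + t)) x)
    (Fin.snoc (α := fun _ => Finset ℕ) y (Finset.Ioc (k + t) (k + t + t))) ?_ ?_ ?_ ?_
  · intro i
    cases i using Fin.cases with
    | zero => simp
    | succ i => simpa using (hx i).2
  · intro i
    cases i using Fin.lastCases with
    | last => simp
    | cast i => simpa using (hy i).2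
  · intro i
    rw [Finset.disjoint_left]
    intro e he he'
    cases i using Fin.cases with
    | zero =>
      rw [Fin.cons_zero, Finset.mem_Ioc] at he
      generalize hi : (0 : Fin (m + 1)) = i at he'
      cases i using Fin.lastCases with
      | last =>
        rw [Fin.snoc_last, Finset.mem_Ioc] at he'
        omega
      | cast i =>
        rw [Fin.snoc_castSucc] at he'
        have := Finset.mem_Icc.1 ((hy i).1 he')
        omega
    | succ i =>
      rw [Fin.cons_succ] at he
      have hk := Finset.mem_Icc.1 ((hx i).1 he)
      generalize hi : i.succ = l at he'
      cases l using Fin.lastCases with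
      | last =>
        rw [Fin.snoc_last, Finset.mem_Ioc] at he'
        omega
      | cast l =>
        rw [Fin.snoc_castSucc] at he'
        have hle := (h i l).1 ⟨e, Finset.mem_inter.2 ⟨he, he'⟩⟩
        have hval := congrArg Fin.val hi
        rw [Fin.le_def] at hle
        simp at hval
        omega
  · intro i j hji
    cases i using Fin.cases with
    | zero => exact absurd hji (Fin.not_lt_zero j)
    | succ i =>
      cases j using Fin.lastCases with
      | last => exact absurd hji (Fin.le_last _).not_gt
      | cast j =>
        rw [Fin.cons_succ, Fin.snoc_castSucc, h]
        exact Fin.le_castSucc_iff.2 hji |> Fin.castSucc_le_castSucc_iff.1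

open Finset in
/-- Triangular families of `a`-sets against `b`-sets, built along Pascal's recursion: two smaller
families on disjoint ground sets and one further pair are glued together with a new point. -/
theorem exists_triangular (a b : ℕ) : ∃ x y : ℕ → Finset ℕ,
    (∀ i < (a + b).choose b - 1, (x i).card = a) ∧
    (∀ i < (a + b).choose b - 1, (y i).card = b) ∧
    ∀ i < (a + b).choose b - 1, ∀ j < (a + b).choose b - 1,
      (x i ∩ y j).Nonempty ↔ j ≤ i := by
  induction a generalizing b with
  | zero => exact ⟨fun _ => ∅, fun _ => ∅, by simp⟩
  | succ a iha =>
  induction b with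
  | zero => exact ⟨fun _ => ∅, fun _ => ∅, by simp⟩
  | succ b ihb =>
  obtain ⟨x₁, y₁, hx₁, hy₁, h₁⟩ := ihb
  obtain ⟨x₂, y₂, hx₂, hy₂, h₂⟩ := iha (b + 1)
  have pascal : (a + 1 + (b + 1)).choose (b + 1) - 1 =
      ((a + 1 + b).choose b - 1) + 1 + ((a + (b + 1)).choose (b + 1) - 1) := by
    have e : a + (b + 1) = a + 1 + b := by omega
    have p₁ : 0 < (a + 1 + b).choose b := Nat.choose_pos (by omega)
    have p₂ : 0 < (a + (b + 1)).choose (b + 1) := Nat.choose_pos (by omega)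
    have := Nat.choose_succ_succ (a + 1 + b) b
    rw [e] at p₂ ⊢
    simp only [Nat.succ_eq_add_one, ← add_assoc] at this ⊢
    omega
  rw [pascal]
  generalize (a + 1 + b).choose b - 1 = M at *
  generalize (a + (b + 1)).choose (b + 1) - 1 = N at *
  obtain ⟨f, f_apply⟩ : ∃ f : ℕ → ℕ ↪ ℕ, ∀ r n, f r n = 4 * n + r + 1 :=
    ⟨fun r => ⟨fun n => 4 * n + r + 1, fun m n h => by simpa using h⟩, fun _ _ => rfl⟩
  have zero_not_mem (r : ℕ) (s : Finset ℕ) : 0 ∉ s.map (f r) := by simp [f_apply]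
  have inter_same (r : ℕ) (s s' : Finset ℕ) :
      (s.map (f r) ∩ s'.map (f r)).Nonempty ↔ (s ∩ s').Nonempty := by
    rw [← Finset.map_inter, Finset.map_nonempty]
  have inter_ne {r r' : ℕ} (hr : r < 4) (hr' : r' < 4) (hne : r ≠ r') (s s' : Finset ℕ) :
      s.map (f r) ∩ s'.map (f r') = ∅ := by
    rw [← Finset.disjoint_iff_inter_eq_empty, Finset.disjoint_left]
    simp only [Finset.mem_map, f_apply]
    rintro _ ⟨u, _, rfl⟩ ⟨v, _, huv⟩
    omega
  refine ⟨fun i => if i < M then (x₁ i).map (f 0) else if i = M then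
      insert 0 ((range a).map (f 1)) else insert 0 ((x₂ (i - (M + 1))).map (f 2)),
    fun i => if i < M then insert 0 ((y₁ i).map (f 0)) else if i = M then
      insert 0 ((range b).map (f 3)) else (y₂ (i - (M + 1))).map (f 2), ?_, ?_, ?_⟩
  · intro i hi
    dsimp only
    split_ifs with c₁ c₂
    · rw [card_map, hx₁ i c₁]
    · rw [card_insert_of_notMem (zero_not_mem _ _), card_map, card_range]
    · rw [card_insert_of_notMem (zero_not_mem _ _), card_map, hx₂ _ (by omega)]
  · intro i hi
    dsimp only
    split_ifs with c₁ c₂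
    · rw [card_insert_of_notMem (zero_not_mem _ _), card_map, hy₁ i c₁]
    · rw [card_insert_of_notMem (zero_not_mem _ _), card_map, card_range]
    · rw [card_map, hy₂ _ (by omega)]
  · intro i hi j hj
    have both (s s' : Finset ℕ) : (insert 0 s ∩ insert 0 s').Nonempty := ⟨0, by simp⟩
    dsimp only
    split_ifs with c₁ d₁ d₂ c₂ d₁ d₂ d₁ d₂
    · rw [inter_insert_of_notMem (zero_not_mem _ _), inter_same, h₁ i c₁ j d₁]
    · rw [inter_insert_of_notMem (zero_not_mem _ _), inter_ne] <;> simp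
      omega
    · rw [inter_ne] <;> simp
      omega
    · exact iff_of_true (both _ _) (by omega)
    · exact iff_of_true (both _ _) (by omega)
    · rw [insert_inter_of_notMem (zero_not_mem _ _), inter_ne] <;> simp
      omega
    · exact iff_of_true (both _ _) (by omega)
    · exact iff_of_true (both _ _) (by omega)
    · rw [insert_inter_of_notMem (zero_not_mem _ _), inter_same,
        h₂ _ (by omega) _ (by omega)]
      omega

/-- for every `t ≥ 1` there exists `K` such that for every
`k ≥ K`, the maximal triangular submatrix of `A_{k,t}` has size exactly
`binom(2t, t) - 1`: a triangular submatrix of that size exists, and every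
triangular submatrix has size at most `binom(2t, t) - 1`. -/
theorem maximal_triangular_submatrix (t : ℕ) (ht : 1 ≤ t) :
    ∃ K : ℕ, ∀ k : ℕ, K ≤ k →
      (∃ x y : Fin (Nat.choose (2 * t) t - 1) → Finset ℕ,
        (∀ i, x i ⊆ Finset.Icc 1 k ∧ (x i).card = t) ∧
        (∀ i, y i ⊆ Finset.Icc 1 k ∧ (y i).card = t) ∧
        (∀ i j, (x i ∩ y j).Nonempty ↔ j ≤ i)) ∧
      (∀ (m : ℕ) (x y : Fin m → Finset ℕ),
        (∀ i, x i ⊆ Finset.Icc 1 k ∧ (x i).card = t) →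
        (∀ i, y i ⊆ Finset.Icc 1 k ∧ (y i).card = t) →
        (∀ i j, (x i ∩ y j).Nonempty ↔ j ≤ i) →
        m ≤ Nat.choose (2 * t) t - 1) := by
  classical
  obtain ⟨x, y, hx, hy, h⟩ := exists_triangular t t
  rw [← two_mul] at hx hy h
  let N := (2 * t).choose t - 1
  let S := (Finset.range N).biUnion x ∪ (Finset.range N).biUnion y
  let shift : ℕ ↪ ℕ := addRightEmbedding 1
  have bound (k : ℕ) (hk : S.sup id + 1 ≤ k) (s : Finset ℕ) (hs : s ⊆ S) :
      s.map shift ⊆ Finset.Icc 1 k := by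
    intro e he
    obtain ⟨n, hn, rfl⟩ := Finset.mem_map.1 he
    have hle : n ≤ S.sup id := Finset.le_sup (f := id) (hs hn)
    simp only [shift, addRightEmbedding_apply, Finset.mem_Icc]
    omega
  refine ⟨S.sup id + 1, fun k hk => ⟨⟨fun i => (x i).map shift, fun i => (y i).map shift,
    fun i => ⟨bound k hk _ ?_, ?_⟩, fun i => ⟨bound k hk _ ?_, ?_⟩, fun i j => ?_⟩, ?_⟩⟩
  · exact (Finset.subset_biUnion_of_mem x (Finset.mem_range.2 i.2)).trans
      Finset.subset_union_left
  · rw [Finset.card_map, hx i i.2]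
  · exact (Finset.subset_biUnion_of_mem y (Finset.mem_range.2 i.2)).trans
      Finset.subset_union_right
  · rw [Finset.card_map, hy i i.2]
  · rw [← Finset.map_inter, Finset.map_nonempty, h i i.2 j j.2, Fin.le_def]
  · intro m x y hx hy h
    exact Nat.le_sub_one_of_lt (card_triangular_lt_choose x y hx hy h)
end

section
/- For every t ≥ 2 and every k ≥ 3t - 2, there exists an isolation set of size k - t + 1 in A_{k,t}. -/
/-- An isolation set of size `n` in `A_{k,t}`: sequences `x` and `y` of
`t`-element subsets of `{1,…,k}` with `x i ∩ y i ≠ ∅` for all `i`, and for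
`i ≠ j`, `x i ∩ y j = ∅` or `x j ∩ y i = ∅`. -/
def IsIsolationSet (k t n : ℕ) (x y : Fin n → Finset ℕ) : Prop :=
  (∀ i, x i ⊆ Finset.Icc 1 k ∧ (x i).card = t) ∧
  (∀ i, y i ⊆ Finset.Icc 1 k ∧ (y i).card = t) ∧
  (∀ i, (x i ∩ y i).Nonempty) ∧
  (∀ i j, i ≠ j → x i ∩ y j = ∅ ∨ x j ∩ y i = ∅)

/-- The cyclic interval of length `t` starting at `j` in `{1,…,n}`. -/
def cyclicInterval (n t j : ℕ) : Finset ℕ :=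
  (Finset.range t).image fun s => (j + s) % n + 1

theorem mem_cyclicInterval {n t j a : ℕ} :
    a ∈ cyclicInterval n t j ↔ ∃ s < t, (j + s) % n + 1 = a := by
  simp [cyclicInterval]

theorem le_of_mem_cyclicInterval {n t j a : ℕ} (hn : 0 < n) (h : a ∈ cyclicInterval n t j) :
    1 ≤ a ∧ a ≤ n := by
  obtain ⟨s, -, rfl⟩ := mem_cyclicInterval.1 h
  have := Nat.mod_lt (j + s) hn
  omega

theorem card_cyclicInterval {n t : ℕ} (htn : t ≤ n) (j : ℕ) :
    (cyclicInterval n t j).card = t := by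
  rw [cyclicInterval, Finset.card_image_of_injOn, Finset.card_range]
  intro a ha b hb hab
  simp only [Finset.coe_range, Set.mem_Iio] at ha hb
  have h : j + a ≡ j + b [MOD n] := Nat.succ_injective hab
  exact (Nat.ModEq.add_left_cancel' j h).eq_of_lt_of_lt (ha.trans_le htn) (hb.trans_le htn)

/-- If `n ≥ 2t - 1`, two distinct points of the `n`-cycle cannot each lie in the interval of
length `t` starting at the other one. -/
theorem eq_of_mem_cyclicInterval {n t i j : ℕ} (hn : 2 * t ≤ n + 1) (hi : i < n) (hj : j < n)
    (hij : i + 1 ∈ cyclicInterval n t j) (hji : j + 1 ∈ cyclicInterval n t i) : i = j := by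
  obtain ⟨a, ha, ha'⟩ := mem_cyclicInterval.1 hij
  obtain ⟨b, hb, hb'⟩ := mem_cyclicInterval.1 hji
  have ea : (j + a) % n = if j + a < n then j + a else j + a - n := by
    split_ifs with h
    · exact Nat.mod_eq_of_lt h
    · rw [Nat.mod_eq_sub_mod (by omega), Nat.mod_eq_of_lt (by omega)]
  have eb : (i + b) % n = if i + b < n then i + b else i + b - n := by
    split_ifs with h
    · exact Nat.mod_eq_of_lt h
    · rw [Nat.mod_eq_sub_mod (by omega), Nat.mod_eq_of_lt (by omega)]
  split_ifs at ea eb <;> omega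

/-- for every `t ≥ 2` and every `k ≥ 3t - 2`, there is an
isolation set of size `k - t + 1` in `A_{k,t}`. -/
theorem isolation_set_of_size_k_sub_t_add_one (t k : ℕ) (ht : 2 ≤ t)
    (hk : 3 * t - 2 ≤ k) :
    ∃ x y : Fin (k - t + 1) → Finset ℕ, IsIsolationSet k t (k - t + 1) x y := by
  refine ⟨fun i => insert (i.1 + 1) (Finset.Icc (k - t + 2) k),
    fun j => cyclicInterval (k - t + 1) t j, fun i => ⟨fun a ha => ?_, ?_⟩,
    fun j => ⟨fun a ha => ?_, card_cyclicInterval (by omega) j⟩,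
    fun i => ⟨i.1 + 1, ?_⟩, fun i j hij => ?_⟩
  · have := i.2
    simp only [Finset.mem_insert, Finset.mem_Icc] at ha ⊢
    omega
  · have := i.2
    rw [Finset.card_insert_of_notMem (by simp only [Finset.mem_Icc]; omega), Nat.card_Icc]
    omega
  · have := le_of_mem_cyclicInterval (by omega) ha
    rw [Finset.mem_Icc]
    omega
  · exact Finset.mem_inter.2 ⟨Finset.mem_insert_self _ _,
      mem_cyclicInterval.2 ⟨0, by omega, by simp only [add_zero, Nat.mod_eq_of_lt i.2]⟩⟩
  · have inter_eq_empty (p q : Fin (k - t + 1))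
        (h : p.1 + 1 ∉ cyclicInterval (k - t + 1) t q) :
        insert (p.1 + 1) (Finset.Icc (k - t + 2) k) ∩ cyclicInterval (k - t + 1) t q = ∅ := by
      refine Finset.eq_empty_of_forall_notMem fun a ha => ?_
      obtain ⟨hx, hy⟩ := Finset.mem_inter.1 ha
      have := le_of_mem_cyclicInterval (by omega) hy
      rcases Finset.mem_insert.1 hx with rfl | hx
      · exact h hy
      · rw [Finset.mem_Icc] at hx
        omega
    by_cases h : i.1 + 1 ∈ cyclicInterval (k - t + 1) t j
    · exact Or.inr <| inter_eq_empty j i fun h' =>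
        hij (Fin.ext (eq_of_mem_cyclicInterval (by omega) i.2 j.2 h h'))
    · exact Or.inl <| inter_eq_empty i j h
end

section
/- Let t ≥ 3 and k = 2t + r where 0 ≤ r ≤ t - 3. Then there exists an isolation set of size 2r + 3 in A_{k,t}. -/
/-- for `t ≥ 3` and `k = 2t + r` with `0 ≤ r ≤ t - 3`, there is
an isolation set of size `2r + 3` in `A_{k,t}`. -/
theorem isolation_set_small_k (t r k : ℕ) (ht : 3 ≤ t) (hr : r ≤ t - 3)
    (hk : k = 2 * t + r) :
    ∃ x y : Fin (2 * r + 3) → Finset ℕ, IsIsolationSet k t (2 * r + 3) x y := by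
  -- Every `x i` is a cyclic point together with a common block, and `y j` is the cyclic interval
  -- of length `r + 2` starting at the point `j` together with another common block.
  let c : ℕ → ℕ → ℕ := fun j d ↦ if j + d < 2 * r + 3 then j + d + 1 else j + d - (2 * r + 2)
  refine ⟨fun i ↦ insert (i.val + 1) (Finset.Icc (2 * r + 4) (2 * r + 2 + t)),
    fun j ↦ (Finset.range (r + 2)).image (c j.val) ∪ Finset.Icc (2 * r + 3 + t) k,
    fun i ↦ ⟨?_, ?_⟩, fun j ↦ ⟨?_, ?_⟩, fun i ↦ ⟨i.val + 1, ?_⟩, fun i j hij ↦ ?_⟩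
  · intro a ha
    simp only [Finset.mem_insert, Finset.mem_Icc] at ha ⊢
    omega
  · rw [Finset.card_insert_of_notMem (by simp only [Finset.mem_Icc]; omega), Nat.card_Icc]
    omega
  · intro a ha
    simp only [Finset.mem_union, Finset.mem_image, Finset.mem_range, Finset.mem_Icc, c] at ha ⊢
    obtain ⟨d, hd, rfl⟩ | ha := ha
    · split_ifs <;> omega
    · omega
  · rw [Finset.card_union_of_disjoint, Finset.card_image_of_injOn, Finset.card_range,
      Nat.card_Icc]
    · omega
    · intro d hd e he h
      simp only [Finset.coe_range, Set.mem_Iio, c] at hd he h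
      split_ifs at h <;> omega
    · rw [Finset.disjoint_left]
      intro a ha hb
      simp only [Finset.mem_image, Finset.mem_range, Finset.mem_Icc, c] at ha hb
      obtain ⟨d, hd, rfl⟩ := ha
      split_ifs at hb <;> omega
  · simp only [Finset.mem_inter, Finset.mem_insert, true_or, Finset.mem_union, Finset.mem_image,
      Finset.mem_range, true_and]
    exact Or.inl ⟨0, by omega, by simp [c]⟩
  · by_contra! h
    obtain ⟨⟨a, ha⟩, ⟨b, hb⟩⟩ := h
    simp only [Finset.mem_inter, Finset.mem_insert, Finset.mem_union, Finset.mem_image,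
      Finset.mem_range, Finset.mem_Icc, c] at ha hb
    have hij' : i.val ≠ j.val := fun h ↦ hij (Fin.ext h)
    obtain ⟨ha, ⟨d, hd, rfl⟩ | ha'⟩ := ha
    · obtain ⟨hb, ⟨e, he, rfl⟩ | hb'⟩ := hb
      · split_ifs at ha hb <;> omega
      · omega
    · omega
end

section
/- Let t ≥ 2 and k = 2t + r where t - 2 ≤ r ≤ 2t - 3. Then there exists an isolation set of size 2r + 3 in A_{k,t}. -/
/-- for `t ≥ 2` and `k = 2t + r` with `t - 2 ≤ r ≤ 2t - 3`,
there is an isolation set of size `2r + 3` in `A_{k,t}`. -/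
theorem isolation_set_big_k (t r k : ℕ) (ht : 2 ≤ t) (hr₁ : t - 2 ≤ r)
    (hr₂ : r ≤ 2 * t - 3) (hk : k = 2 * t + r) :
    ∃ x y : Fin (2 * r + 3) → Finset ℕ, IsIsolationSet k t (2 * r + 3) x y := by
  have hinj : ∀ i : Fin (2 * r + 3), Set.InjOn
      (fun s ↦ if i.1 + s < 2 * r + 3 then i.1 + s + 1 else i.1 + s + 1 - (2 * r + 3))
      (Finset.range (r + 3 - t) : Set ℕ) := by
    intro i s hs u hu h
    simp only [Finset.coe_range, Set.mem_Iio] at hs hu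
    dsimp only at h
    split_ifs at h <;> omega
  have hinj' : ∀ i : Fin (2 * r + 3), Set.InjOn
      (fun s ↦ if s ≤ i.1 then i.1 + 1 - s else i.1 + 1 + (2 * r + 3) - s)
      (Finset.range t : Set ℕ) := by
    intro i s hs u hu h
    simp only [Finset.coe_range, Set.mem_Iio] at hs hu
    dsimp only at h
    split_ifs at h <;> omega
  -- Cyclic intervals modulo `2r + 3` of lengths `r + 3 - t` (starting at `i`) and `t` (ending
  -- at `i`); the former are padded by the points outside the cycle.
  refine ⟨fun i ↦ (Finset.range (r + 3 - t)).image
      (fun s ↦ if i.1 + s < 2 * r + 3 then i.1 + s + 1 else i.1 + s + 1 - (2 * r + 3)) ∪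
      Finset.Icc (2 * r + 4) k,
    fun i ↦ (Finset.range t).image
      (fun s ↦ if s ≤ i.1 then i.1 + 1 - s else i.1 + 1 + (2 * r + 3) - s),
    fun i ↦ ⟨?_, ?_⟩, fun i ↦ ⟨?_, ?_⟩, fun i ↦ ⟨i.1 + 1, ?_⟩, fun i j hij ↦ ?_⟩
  · intro z hz
    simp only [Finset.mem_union, Finset.mem_image, Finset.mem_range, Finset.mem_Icc] at hz ⊢
    rcases hz with ⟨s, hs, rfl⟩ | hz
    · split_ifs <;> omega
    · omega
  · rw [Finset.card_union_of_disjoint, Finset.card_image_of_injOn (hinj i), Finset.card_range,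
      Nat.card_Icc]
    · omega
    · rw [Finset.disjoint_left]
      intro z hz hz'
      simp only [Finset.mem_image, Finset.mem_range, Finset.mem_Icc] at hz hz'
      obtain ⟨s, hs, rfl⟩ := hz
      split_ifs at hz' <;> omega
  · intro z hz
    simp only [Finset.mem_image, Finset.mem_range, Finset.mem_Icc] at hz ⊢
    obtain ⟨s, hs, rfl⟩ := hz
    split_ifs <;> omega
  · rw [Finset.card_image_of_injOn (hinj' i), Finset.card_range]
  · simp only [Finset.mem_inter, Finset.mem_union, Finset.mem_image, Finset.mem_range]
    exact ⟨Or.inl ⟨0, by omega, by simp⟩, 0, by omega, by simp⟩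
  · have hij' : i.1 ≠ j.1 := fun h ↦ hij (Fin.ext h)
    by_contra! h
    obtain ⟨⟨z, hz⟩, ⟨w, hw⟩⟩ := h
    simp only [Finset.mem_inter, Finset.mem_union, Finset.mem_image, Finset.mem_range,
      Finset.mem_Icc] at hz hw
    obtain ⟨hz, u, hu, hzu⟩ := hz
    obtain ⟨hw, v, hv, hwv⟩ := hw
    have hz' : z ≤ 2 * r + 3 := by split_ifs at hzu <;> omega
    have hw' : w ≤ 2 * r + 3 := by split_ifs at hwv <;> omega
    obtain ⟨s, hs, hsz⟩ := hz.resolve_right (by omega)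
    obtain ⟨p, hp, hpw⟩ := hw.resolve_right (by omega)
    split_ifs at hzu hwv hsz hpw <;> omega
end

section
/- Let t ≥ 2 and k = 2t + 1. Then every isolation set in A_{k,t} has size at most 5. -/
open Finset

open Classical in
/-- The number of covering pairs `a ⋖ b` with `a ∈ A` and `b ∈ B`. -/
noncomputable def coverCount {α : Type*} (A B : Finset (Finset α)) : ℕ :=
  ∑ a ∈ A, ∑ b ∈ B, if a ⋖ b then 1 else 0

theorem covBy_iff_eq_insert_of_mem {α : Type*} [DecidableEq α] {a b : Finset α} {c : α}
    (ha : c ∉ a) (hb : c ∈ b) : a ⋖ b ↔ b = insert c a := by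
  rw [Finset.covBy_iff_exists_insert]
  constructor
  · rintro ⟨d, hd, rfl⟩
    rcases Finset.mem_insert.1 hb with rfl | h
    · rfl
    · exact absurd h ha
  · rintro rfl
    exact ⟨c, ha, rfl⟩

theorem coverCount_eq_card_filter {α : Type*} [DecidableEq α] {A B : Finset (Finset α)} {c : α}
    (hA : ∀ a ∈ A, c ∉ a) (hB : ∀ b ∈ B, c ∈ b) :
    coverCount A B = #{a ∈ A | insert c a ∈ B} := by
  classical
  rw [coverCount, Finset.card_filter]
  refine Finset.sum_congr rfl fun a ha => ?_
  rw [← Finset.sum_ite_eq' B (insert c a) fun _ => 1]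
  refine Finset.sum_congr rfl fun b hb => ?_
  simp only [covBy_iff_eq_insert_of_mem (hA a ha) (hB b hb)]

theorem coverCount_le_card_left {α : Type*} [DecidableEq α] {A B : Finset (Finset α)} {c : α}
    (hA : ∀ a ∈ A, c ∉ a) (hB : ∀ b ∈ B, c ∈ b) : coverCount A B ≤ #A := by
  rw [coverCount_eq_card_filter hA hB]
  exact Finset.card_filter_le _ _

theorem coverCount_le_card_right {α : Type*} [DecidableEq α] {A B : Finset (Finset α)} {c : α}
    (hA : ∀ a ∈ A, c ∉ a) (hB : ∀ b ∈ B, c ∈ b) : coverCount A B ≤ #B := by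
  rw [coverCount_eq_card_filter hA hB]
  refine Finset.card_le_card_of_injOn (insert c) (fun a ha => ?_) fun a ha a' ha' h => ?_
  · simp only [Finset.coe_filter, Set.mem_ofPred_eq] at ha
    exact ha.2
  · simp only [Finset.coe_filter, Set.mem_ofPred_eq] at ha ha'
    rw [← Finset.erase_insert (hA a ha.1), h, Finset.erase_insert (hA a' ha'.1)]

theorem insert_mem_of_coverCount_eq {α : Type*} [DecidableEq α] {A B : Finset (Finset α)} {c : α}
    (hA : ∀ a ∈ A, c ∉ a) (hB : ∀ b ∈ B, c ∈ b) (h : #A ≤ coverCount A B) :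
    ∀ a ∈ A, insert c a ∈ B := by
  rw [coverCount_eq_card_filter hA hB] at h
  have := Finset.eq_of_subset_of_card_le (Finset.filter_subset _ _) h
  exact Finset.filter_eq_self.1 this

theorem coverCount_split {α : Type*} [DecidableEq α] (A B : Finset (Finset α)) (c : α) :
    coverCount A B = coverCount {a ∈ A | c ∉ a} {b ∈ B | c ∉ b} +
      coverCount {a ∈ A | c ∈ a} {b ∈ B | c ∈ b} +
      coverCount {a ∈ A | c ∉ a} {b ∈ B | c ∈ b} := by
  classical
  have h0 : coverCount {a ∈ A | c ∈ a} {b ∈ B | c ∉ b} = 0 := by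
    refine Finset.sum_eq_zero fun a ha => Finset.sum_eq_zero fun b hb => if_neg fun h => ?_
    exact (Finset.mem_filter.1 hb).2 (h.le (Finset.mem_filter.1 ha).2)
  have h1 : ∀ A' : Finset (Finset α), coverCount A' B =
      coverCount A' {b ∈ B | c ∈ b} + coverCount A' {b ∈ B | c ∉ b} := by
    intro A'
    rw [coverCount, coverCount, coverCount, ← Finset.sum_add_distrib]
    exact Finset.sum_congr rfl fun a _ => (Finset.sum_filter_add_sum_filter_not _ _ _).symm
  have h2 : coverCount A B = coverCount {a ∈ A | c ∈ a} B + coverCount {a ∈ A | c ∉ a} B :=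
    (Finset.sum_filter_add_sum_filter_not _ _ _).symm
  have := h1 {a ∈ A | c ∈ a}
  have := h1 {a ∈ A | c ∉ a}
  omega

theorem exists_split_of_coverCount_pos {α : Type*} [DecidableEq α] {A B : Finset (Finset α)}
    (h : 0 < coverCount A B) :
    ∃ c, 0 < #{a ∈ A | c ∉ a} ∧ 0 < #{b ∈ B | c ∈ b} := by
  classical
  obtain ⟨a, ha, h⟩ := Finset.exists_ne_zero_of_sum_ne_zero h.ne'
  obtain ⟨b, hb, h⟩ := Finset.exists_ne_zero_of_sum_ne_zero h
  have hab : a ⋖ b := by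
    by_contra hab
    exact h (if_neg hab)
  obtain ⟨c, hc, rfl⟩ := Finset.covBy_iff_exists_insert.1 hab
  exact ⟨c, Finset.card_pos.2 ⟨a, by simp [ha, hc]⟩,
    Finset.card_pos.2 ⟨_, Finset.mem_filter.2 ⟨hb, Finset.mem_insert_self c a⟩⟩⟩

/-- An upper bound for the number of covering pairs between families of `a` and of `b` sets,
for `a, b ≤ 6`. -/
def coverBound (a b : ℕ) : ℕ :=
  ([[0, 0, 0, 0, 0, 0, 0],
    [0, 1, 2, 3, 4, 5, 6],
    [0, 2, 3, 4, 5, 6, 7],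
    [0, 3, 4, 6, 7, 8, 9],
    [0, 4, 5, 7, 9, 10, 12],
    [0, 5, 6, 8, 10, 12, 13],
    [0, 6, 7, 9, 12, 13, 15]].getD a []).getD b 0

theorem coverBound_split {a0 a1 b0 b1 : ℕ} (ha0 : 0 < a0) (hb1 : 0 < b1) (ha : a0 + a1 ≤ 6)
    (hb : b0 + b1 ≤ 6) :
    coverBound a0 b0 + coverBound a1 b1 + min a0 b1 ≤ coverBound (a0 + a1) (b0 + b1) := by
  have key : ∀ a0 a1 b0 b1 : Fin 7, 0 < a0.1 ∧ 0 < b1.1 ∧ a0.1 + a1.1 ≤ 6 ∧ b0.1 + b1.1 ≤ 6 →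
      coverBound a0 b0 + coverBound a1 b1 + min a0.1 b1.1 ≤
        coverBound (a0.1 + a1.1) (b0.1 + b1.1) := by
    decide +kernel
  exact key ⟨a0, by omega⟩ ⟨a1, by omega⟩ ⟨b0, by omega⟩ ⟨b1, by omega⟩ ⟨ha0, hb1, ha, hb⟩

theorem coverBound_split_tight {a0 a1 b0 b1 : ℕ} (ha0 : 0 < a0) (hb1 : 0 < b1)
    (ha : a0 + a1 = 6) (hb : b0 + b1 = 6)
    (h : 15 ≤ coverBound a0 b0 + coverBound a1 b1 + min a0 b1) :
    (a0 = 3 ∧ a1 = 3 ∧ b0 = 3 ∧ b1 = 3) ∨ (a0 = 5 ∧ a1 = 1 ∧ b0 = 1 ∧ b1 = 5) := by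
  have key : ∀ a0 a1 b0 b1 : Fin 7,
      0 < a0.1 ∧ 0 < b1.1 ∧ a0.1 + a1.1 = 6 ∧ b0.1 + b1.1 = 6 ∧
        15 ≤ coverBound a0 b0 + coverBound a1 b1 + min a0.1 b1.1 →
      (a0.1 = 3 ∧ a1.1 = 3 ∧ b0.1 = 3 ∧ b1.1 = 3) ∨
        (a0.1 = 5 ∧ a1.1 = 1 ∧ b0.1 = 1 ∧ b1.1 = 5) := by
    decide +kernel
  exact key ⟨a0, by omega⟩ ⟨a1, by omega⟩ ⟨b0, by omega⟩ ⟨b1, by omega⟩ ⟨ha0, hb1, ha, hb, h⟩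

theorem card_filter_mem_add_card_filter_notMem {α : Type*} [DecidableEq α]
    (A : Finset (Finset α)) (c : α) : #{a ∈ A | c ∉ a} + #{a ∈ A | c ∈ a} = #A := by
  rw [add_comm]
  exact Finset.card_filter_add_card_filter_not _

theorem coverCount_le_coverBound {α : Type*} [DecidableEq α] (A B : Finset (Finset α))
    (hA : #A ≤ 6) (hB : #B ≤ 6) : coverCount A B ≤ coverBound #A #B := by
  induction hn : #A + #B using Nat.strong_induction_on generalizing A B with
  | _ n ih =>
  rcases Nat.eq_zero_or_pos (coverCount A B) with h0 | hpos
  · omega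
  obtain ⟨c, ha0, hb1⟩ := exists_split_of_coverCount_pos hpos
  have hAc := card_filter_mem_add_card_filter_notMem A c
  have hBc := card_filter_mem_add_card_filter_notMem B c
  have h0 := ih _ (by omega) {a ∈ A | c ∉ a} {b ∈ B | c ∉ b} (by omega) (by omega) rfl
  have h1 := ih _ (by omega) {a ∈ A | c ∈ a} {b ∈ B | c ∈ b} (by omega) (by omega) rfl
  have hl : coverCount {a ∈ A | c ∉ a} {b ∈ B | c ∈ b} ≤ _ :=
    coverCount_le_card_left (c := c) (by simp) (by simp)
  have hr : coverCount {a ∈ A | c ∉ a} {b ∈ B | c ∈ b} ≤ _ :=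
    coverCount_le_card_right (c := c) (by simp) (by simp)
  have hs := coverBound_split ha0 hb1
    (hAc.trans_le hA) (hBc.trans_le hB)
  rw [hAc, hBc] at hs
  rw [coverCount_split A B c]
  omega

set_option synthInstance.maxHeartbeats 400000 in
set_option synthInstance.maxSize 2000 in
theorem bool_matrix_three_of_no_rectangle : ∀ r : Fin 3 → Fin 3 → Bool,
    (∀ i i' j j', i ≠ i' ∧ j ≠ j' → ¬ (r i j ∧ r i' j ∧ r i j' ∧ r i' j')) →
    6 ≤ ∑ i, ∑ j, (r i j).toNat →
    (∀ i i', i ≠ i' → ∃ j, r i j ∧ r i' j) ∧ (∀ j, ∃ i, ¬ r i j) ∧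
      (∀ j j', j ≠ j' → ∃ i, r i j ∧ r i j') ∧ (∀ i, ∃ j, ¬ r i j) := by
  decide +kernel

theorem covBy_rectangle {α : Type*} [DecidableEq α] {a a' b b' : Finset α} (ha : a ≠ a')
    (hb : b ≠ b') (h1 : a ⋖ b) (h2 : a' ⋖ b) (h3 : a ⋖ b') (h4 : a' ⋖ b') : False :=
  hb ((h1.wcovBy.sup_eq h2.wcovBy ha).symm.trans (h3.wcovBy.sup_eq h4.wcovBy ha))

theorem covBy_of_six_le_coverCount {α : Type*} [DecidableEq α] {A B : Finset (Finset α)}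
    (hA : #A = 3) (hB : #B = 3) (h : 6 ≤ coverCount A B) :
    (∀ a ∈ A, ∀ a' ∈ A, a ≠ a' → ∃ b ∈ B, a ⋖ b ∧ a' ⋖ b) ∧
      (∀ b ∈ B, ∃ a ∈ A, ¬ a ⋖ b) ∧
      (∀ b ∈ B, ∀ b' ∈ B, b ≠ b' → ∃ a ∈ A, a ⋖ b ∧ a ⋖ b') ∧
      (∀ a ∈ A, ∃ b ∈ B, ¬ a ⋖ b) := by
  classical
  let f := (A.equivFinOfCardEq hA).symm
  let g := (B.equivFinOfCardEq hB).symm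
  have key := bool_matrix_three_of_no_rectangle (fun i j => decide ((f i).1 ⋖ (g j).1))
    (fun i i' j j' hij hr => covBy_rectangle
      (fun e => hij.1 (f.injective (Subtype.ext e))) (fun e => hij.2 (g.injective (Subtype.ext e)))
      (of_decide_eq_true hr.1) (of_decide_eq_true hr.2.1) (of_decide_eq_true hr.2.2.1)
      (of_decide_eq_true hr.2.2.2)) (by
    refine h.trans_eq ?_
    rw [coverCount, ← Finset.sum_coe_sort A, ← f.sum_comp]
    refine Finset.sum_congr rfl fun i _ => ?_
    rw [← Finset.sum_coe_sort B, ← g.sum_comp]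
    refine Finset.sum_congr rfl fun j _ => ?_
    by_cases hij : (f i).1 ⋖ (g j).1 <;> simp [hij])
  simp only [decide_eq_true_eq] at key
  obtain ⟨h1, h2, h3, h4⟩ := key
  have hf : ∀ a ∈ A, ∃ i, (f i).1 = a := fun a ha =>
    (f.surjective ⟨a, ha⟩).imp fun i hi => congrArg Subtype.val hi
  have hg : ∀ b ∈ B, ∃ j, (g j).1 = b := fun b hb =>
    (g.surjective ⟨b, hb⟩).imp fun j hj => congrArg Subtype.val hj
  refine ⟨fun a ha a' ha' hne => ?_, fun b hb => ?_, fun b hb b' hb' hne => ?_, fun a ha => ?_⟩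
  · obtain ⟨i, rfl⟩ := hf a ha
    obtain ⟨i', rfl⟩ := hf a' ha'
    obtain ⟨j, hj⟩ := h1 i i' fun e => hne (by rw [e])
    exact ⟨g j, (g j).2, hj⟩
  · obtain ⟨j, rfl⟩ := hg b hb
    obtain ⟨i, hi⟩ := h2 j
    exact ⟨f i, (f i).2, hi⟩
  · obtain ⟨j, rfl⟩ := hg b hb
    obtain ⟨j', rfl⟩ := hg b' hb'
    obtain ⟨i, hi⟩ := h3 j j' fun e => hne (by rw [e])
    exact ⟨f i, (f i).2, hi⟩
  · obtain ⟨i, rfl⟩ := hf a ha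
    obtain ⟨j, hj⟩ := h4 i
    exact ⟨g j, (g j).2, hj⟩

theorem not_common_covers_of_three {α : Type*} [DecidableEq α] {c : α}
    {x1 x2 x3 a b : Finset α} (h12 : x1 ≠ x2) (h13 : x1 ≠ x3) (h23 : x2 ≠ x3)
    (hc1 : c ∉ x1) (hc2 : c ∉ x2) (hc3 : c ∉ x3)
    (hb1 : x1 ⋖ b) (hb2 : x2 ⋖ b) (hb3 : x3 ⋖ b)
    (ha1 : a ⋖ insert c x1) (ha2 : a ⋖ insert c x2) (ha3 : a ⋖ insert c x3) : False := by
  have hi12 : insert c x1 ≠ insert c x2 := fun e => h12 (by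
    rw [← Finset.erase_insert hc1, e, Finset.erase_insert hc2])
  have hi13 : insert c x1 ≠ insert c x3 := fun e => h13 (by
    rw [← Finset.erase_insert hc1, e, Finset.erase_insert hc3])
  have u12 : x1 ∪ x2 = b := hb1.wcovBy.sup_eq hb2.wcovBy h12
  have u23 : x2 ∪ x3 = b := hb2.wcovBy.sup_eq hb3.wcovBy h23
  have i12 : insert c x1 ∩ insert c x2 = a := ha1.wcovBy.inf_eq ha2.wcovBy hi12
  have i13 : insert c x1 ∩ insert c x3 = a := ha1.wcovBy.inf_eq ha3.wcovBy hi13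
  obtain ⟨p, hp, hpb⟩ := Finset.covBy_iff_exists_insert.1 hb2
  have hp12 : p ∈ x1 ∪ x2 := by rw [u12, ← hpb]; exact Finset.mem_insert_self p x2
  have hp23 : p ∈ x2 ∪ x3 := by rwa [u23, ← u12]
  have hp1 : p ∈ x1 := (Finset.mem_union.1 hp12).resolve_right hp
  have hp3 : p ∈ x3 := (Finset.mem_union.1 hp23).resolve_left hp
  have hpc : p ≠ c := fun e => hc1 (e ▸ hp1)
  have hp13 : p ∈ insert c x1 ∩ insert c x3 := by simp [hp1, hp3]
  rw [i13, ← i12] at hp13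
  simp [hp, hpc] at hp13

theorem not_distinct_common_covers_of_three {α : Type*} [DecidableEq α] {c : α}
    {x1 x2 x3 a12 a13 b12 b23 : Finset α} (h12 : x1 ≠ x2) (h13 : x1 ≠ x3) (h23 : x2 ≠ x3)
    (hc1 : c ∉ x1) (hc2 : c ∉ x2) (hc3 : c ∉ x3)
    (hb1 : x1 ⋖ b12) (hb2 : x2 ⋖ b12) (hb2' : x2 ⋖ b23) (hb3 : x3 ⋖ b23)
    (ha1 : a12 ⋖ insert c x1) (ha2 : a12 ⋖ insert c x2)
    (ha1' : a13 ⋖ insert c x1) (ha3 : a13 ⋖ insert c x3)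
    (ha : a12 ≠ a13) (hb : b12 ≠ b23) : False := by
  have hi12 : insert c x1 ≠ insert c x2 := fun e => h12 (by
    rw [← Finset.erase_insert hc1, e, Finset.erase_insert hc2])
  have hi13 : insert c x1 ≠ insert c x3 := fun e => h13 (by
    rw [← Finset.erase_insert hc1, e, Finset.erase_insert hc3])
  have u12 : x1 ∪ x2 = b12 := hb1.wcovBy.sup_eq hb2.wcovBy h12
  have u23 : x2 ∪ x3 = b23 := hb2'.wcovBy.sup_eq hb3.wcovBy h23
  have i12 : insert c x1 ∩ insert c x2 = a12 := ha1.wcovBy.inf_eq ha2.wcovBy hi12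
  have i13 : insert c x1 ∩ insert c x3 = a13 := ha1'.wcovBy.inf_eq ha3.wcovBy hi13
  obtain ⟨p, hp, hpb⟩ := Finset.covBy_iff_exists_insert.1 hb2
  have hp12 : p ∈ x1 ∪ x2 := by rw [u12, ← hpb]; exact Finset.mem_insert_self p x2
  have hp1 : p ∈ x1 := (Finset.mem_union.1 hp12).resolve_right hp
  have hp3 : p ∉ x3 := by
    intro hp3
    have hpb' : p ∈ b23 := u23 ▸ Finset.mem_union_right x2 hp3
    exact hb (hpb.symm.trans ((covBy_iff_eq_insert_of_mem hp hpb').1 hb2').symm)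
  have hpc : p ≠ c := fun e => hc1 (e ▸ hp1)
  have hpi : p ∈ insert c x1 := Finset.mem_insert_of_mem hp1
  have hpa : p ∉ a12 := by simp [← i12, hp, hpc]
  have hpa' : p ∉ a13 := by simp [← i13, hp3, hpc]
  have e := (covBy_iff_eq_insert_of_mem hpa hpi).1 ha1
  have e' := (covBy_iff_eq_insert_of_mem hpa' hpi).1 ha1'
  exact ha (by rw [← Finset.erase_insert hpa, ← e, e', Finset.erase_insert hpa'])

theorem coverCount_singleton_right {α : Type*} {A : Finset (Finset α)} {b : Finset α}
    (h : #A ≤ coverCount A {b}) : ∀ a ∈ A, a ⋖ b := by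
  classical
  simp only [coverCount, Finset.sum_singleton, ← Finset.card_filter] at h
  exact Finset.filter_eq_self.1 (Finset.eq_of_subset_of_card_le (Finset.filter_subset _ _) h)

theorem coverCount_singleton_left {α : Type*} {B : Finset (Finset α)} {a : Finset α}
    (h : #B ≤ coverCount {a} B) : ∀ b ∈ B, a ⋖ b := by
  classical
  simp only [coverCount, Finset.sum_singleton, ← Finset.card_filter] at h
  exact Finset.filter_eq_self.1 (Finset.eq_of_subset_of_card_le (Finset.filter_subset _ _) h)

theorem coverCount_lt_fifteen {α : Type*} [DecidableEq α] {A B : Finset (Finset α)}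
    (hA : #A = 6) (hB : #B = 6) : coverCount A B < 15 := by
  by_contra! hcount
  obtain ⟨c, ha0, hb1⟩ := exists_split_of_coverCount_pos (by omega : 0 < coverCount A B)
  have hAc := card_filter_mem_add_card_filter_notMem A c
  have hBc := card_filter_mem_add_card_filter_notMem B c
  rw [coverCount_split A B c] at hcount
  have hA0 : ∀ a ∈ ({a ∈ A | c ∉ a} : Finset _), c ∉ a := by simp
  have hB1 : ∀ b ∈ ({b ∈ B | c ∈ b} : Finset _), c ∈ b := by simp
  generalize ({a ∈ A | c ∉ a} : Finset _) = A0 at *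
  generalize ({a ∈ A | c ∈ a} : Finset _) = A1 at *
  generalize ({b ∈ B | c ∉ b} : Finset _) = B0 at *
  generalize ({b ∈ B | c ∈ b} : Finset _) = B1 at *
  have h0 := coverCount_le_coverBound A0 B0 (by omega) (by omega)
  have h1 := coverCount_le_coverBound A1 B1 (by omega) (by omega)
  have hl := coverCount_le_card_left hA0 hB1
  have hr := coverCount_le_card_right hA0 hB1
  rcases coverBound_split_tight ha0 hb1 (hAc.trans hA) (hBc.trans hB) (by omega) with
    ⟨e1, e2, e3, e4⟩ | ⟨e1, e2, e3, e4⟩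
  · rw [e1, e3, show coverBound 3 3 = 6 from rfl] at h0
    rw [e2, e4, show coverBound 3 3 = 6 from rfl] at h1
    obtain ⟨x1, x2, x3, h12, h13, h23, rfl⟩ := Finset.card_eq_three.1 e1
    have hins := insert_mem_of_coverCount_eq hA0 hB1 (by omega)
    obtain ⟨hup, hup', -, -⟩ := covBy_of_six_le_coverCount e1 e3 (by omega)
    obtain ⟨-, -, hdown, hdown'⟩ := covBy_of_six_le_coverCount e2 e4 (by omega)
    have hinj : Set.InjOn (insert c) (({x1, x2, x3} : Finset (Finset α)) : Set (Finset α)) :=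
      fun a ha a' ha' h => by
        rw [← Finset.erase_insert (hA0 a ha), h, Finset.erase_insert (hA0 a' ha')]
    have hsurj := Finset.surjOn_of_injOn_of_card_le (insert c) hins hinj (by omega)
    have m1 : x1 ∈ ({x1, x2, x3} : Finset (Finset α)) := by simp
    have m2 : x2 ∈ ({x1, x2, x3} : Finset (Finset α)) := by simp
    have m3 : x3 ∈ ({x1, x2, x3} : Finset (Finset α)) := by simp
    obtain ⟨b12, -, hb1, hb2⟩ := hup x1 m1 x2 m2 h12
    obtain ⟨b23, hb, hb2', hb3⟩ := hup x2 m2 x3 m3 h23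
    obtain ⟨a12, -, ha1, ha2⟩ := hdown _ (hins x1 m1) _ (hins x2 m2) (hinj.ne m1 m2 h12)
    obtain ⟨a13, ha, ha1', ha3⟩ := hdown _ (hins x1 m1) _ (hins x3 m3) (hinj.ne m1 m3 h13)
    refine not_distinct_common_covers_of_three h12 h13 h23 (hA0 _ m1) (hA0 _ m2) (hA0 _ m3)
      hb1 hb2 hb2' hb3 ha1 ha2 ha1' ha3 ?_ ?_
    · rintro rfl
      obtain ⟨y, hy, hay⟩ := hdown' _ ha
      obtain ⟨x, hx, rfl⟩ := hsurj hy
      simp only [Finset.coe_insert, Finset.coe_singleton, Set.mem_insert_iff,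
        Set.mem_singleton_iff] at hx
      rcases hx with rfl | rfl | rfl
      exacts [hay ha1, hay ha2, hay ha3]
    · rintro rfl
      obtain ⟨x, hx, hxb⟩ := hup' _ hb
      simp only [Finset.mem_insert, Finset.mem_singleton] at hx
      rcases hx with rfl | rfl | rfl
      exacts [hxb hb1, hxb hb2, hxb hb3]
  · rw [e1, e3, show coverBound 5 1 = 5 from rfl] at h0
    rw [e2, e4, show coverBound 1 5 = 5 from rfl] at h1
    obtain ⟨b, rfl⟩ := Finset.card_eq_one.1 e3
    obtain ⟨a, rfl⟩ := Finset.card_eq_one.1 e2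
    have hins := insert_mem_of_coverCount_eq hA0 hB1 (by omega)
    have hup := coverCount_singleton_right (A := A0) (b := b) (by omega)
    have hdown := coverCount_singleton_left (B := B1) (a := a) (by omega)
    obtain ⟨x1, m1, x2, m2, x3, m3, h12, h13, h23⟩ :=
      Finset.two_lt_card.1 (by omega : 2 < #A0)
    exact not_common_covers_of_three h12 h13 h23 (hA0 _ m1) (hA0 _ m2) (hA0 _ m3)
      (hup _ m1) (hup _ m2) (hup _ m3) (hdown _ (hins _ m1)) (hdown _ (hins _ m2))
      (hdown _ (hins _ m3))

/-- for `t ≥ 2` and `k = 2t + 1`, every isolation set in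
`A_{k,t}` has size at most `5`. -/
theorem isolation_set_upper_bound_k_eq_2t_add_one (t k n : ℕ) (ht : 2 ≤ t)
    (hk : k = 2 * t + 1) (x y : Fin n → Finset ℕ)
    (h : IsIsolationSet k t n x y) : n ≤ 5 := by
  classical
  by_contra! hn
  obtain ⟨hx, hy, hne, hiso⟩ := h
  let e : Fin 6 ↪ Fin n := Fin.castLEEmb hn
  have hxinj : Function.Injective x := by
    intro i j hij
    by_contra hne'
    rcases hiso i j hne' with h | h
    · exact (hne j).ne_empty (hij ▸ h)
    · exact (hne i).ne_empty (hij ▸ h)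
  have hyinj : Function.Injective y := by
    intro i j hij
    by_contra hne'
    rcases hiso i j hne' with h | h
    · exact (hne i).ne_empty (hij ▸ h)
    · exact (hne j).ne_empty (hij ▸ h)
  let z : Fin n → Finset ℕ := fun i => Finset.Icc 1 k \ y i
  have hzinj : Function.Injective z := by
    intro i j hij
    apply hyinj
    rw [← Finset.sdiff_sdiff_eq_self (hy i).1, ← Finset.sdiff_sdiff_eq_self (hy j).1]
    exact congrArg (Finset.Icc 1 k \ ·) hij
  have hcov : ∀ i j, x i ∩ y j = ∅ → x i ⋖ z j := by
    intro i j hij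
    have hsub : x i ⊆ z j := Finset.subset_sdiff.2
      ⟨(hx i).1, Finset.disjoint_iff_inter_eq_empty.2 hij⟩
    have hcard : #(z j) = t + 1 := by
      rw [Finset.card_sdiff_of_subset (hy j).1, (hy j).2, Nat.card_Icc]
      omega
    rw [Finset.covBy_iff_card_sdiff_eq_one]
    refine ⟨hsub, ?_⟩
    rw [Finset.card_sdiff_of_subset hsub, hcard, (hx i).2]
    omega
  have hlt := coverCount_lt_fifteen (A := Finset.univ.map (e.trans ⟨x, hxinj⟩))
    (B := Finset.univ.map (e.trans ⟨z, hzinj⟩)) (by simp) (by simp)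
  simp only [coverCount, Finset.sum_map, Function.Embedding.trans_apply,
    Function.Embedding.coeFn_mk] at hlt
  have hpair : ∀ i j : Fin 6, (if i = j then 0 else 1) ≤
      (if x (e i) ⋖ z (e j) then 1 else 0) + (if x (e j) ⋖ z (e i) then 1 else 0) := by
    intro i j
    by_cases hij : i = j
    · simp [hij]
    · rcases hiso (e i) (e j) (e.injective.ne hij) with h | h <;> simp [hij, hcov _ _ h]
  have hsum := Finset.sum_le_sum fun i (_ : i ∈ Finset.univ) =>
    Finset.sum_le_sum fun j (_ : j ∈ Finset.univ) => hpair i j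
  simp only [Finset.sum_add_distrib] at hsum
  rw [Finset.sum_comm (f := fun i j => if x (e j) ⋖ z (e i) then 1 else 0)] at hsum
  have : ∑ i : Fin 6, ∑ j : Fin 6, (if i = j then 0 else 1) = 30 := by decide
  omega
end

section
/- Let t ≥ 1 and k = 2t + 1, and let x_1,...,x_n and y_1,...,y_n form an isolation set in A_{k,t}. Then there do not exist indices i ≠ j and l ≠ m such that x_i ∩ y_l = ∅, x_i ∩ y_m = ∅, x_j ∩ y_l = ∅ and x_j ∩ y_m = ∅. (That is, the corresponding isolation submatrix contains no 2 × 2 all-zero submatrix.) -/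
/-- The union of two distinct finite sets of the same cardinality `t` has more than `t` elements. -/
theorem Finset.lt_card_union_of_ne_of_card_eq {α : Type*} [DecidableEq α] {a b : Finset α} {t : ℕ}
    (hab : a ≠ b) (ha : a.card = t) (hb : b.card = t) : t < (a ∪ b).card := by
  by_contra! hle
  have hua : a = a ∪ b := Finset.eq_of_subset_of_card_le Finset.subset_union_left (by omega)
  have hub : b = a ∪ b := Finset.eq_of_subset_of_card_le Finset.subset_union_right (by omega)
  exact hab (hua.trans hub.symm)

/-- for `t ≥ 1` and `k = 2t + 1`, an isolation set in `A_{k,t}`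
has no `2 × 2` all-zero submatrix: there are no `i ≠ j` and `l ≠ m` with
`x i ∩ y l = x i ∩ y m = x j ∩ y l = x j ∩ y m = ∅`. -/
theorem isolation_set_no_two_by_two_zero_block (t k n : ℕ) (ht : 1 ≤ t)
    (hk : k = 2 * t + 1) (x y : Fin n → Finset ℕ)
    (h : IsIsolationSet k t n x y) :
    ¬ ∃ i j l m : Fin n, i ≠ j ∧ l ≠ m ∧
        x i ∩ y l = ∅ ∧ x i ∩ y m = ∅ ∧ x j ∩ y l = ∅ ∧ x j ∩ y m = ∅ := by
  obtain ⟨hx, hy, hxy, hiso⟩ := h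
  rintro ⟨i, j, l, m, hij, hlm, hil, him, hjl, hjm⟩
  have hx_ne : x i ≠ x j := by
    intro e
    rcases hiso i j hij with h | h
    · exact (hxy j).ne_empty (e ▸ h)
    · exact (hxy i).ne_empty (e ▸ h)
  have hy_ne : y l ≠ y m := by
    intro e
    rcases hiso l m hlm with h | h
    · exact (hxy l).ne_empty (e ▸ h)
    · exact (hxy m).ne_empty (e ▸ h)
  have hX := Finset.lt_card_union_of_ne_of_card_eq hx_ne (hx i).2 (hx j).2
  have hY := Finset.lt_card_union_of_ne_of_card_eq hy_ne (hy l).2 (hy m).2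
  have hdisj : Disjoint (x i ∪ x j) (y l ∪ y m) := by
    rw [← Finset.disjoint_iff_inter_eq_empty] at hil him hjl hjm
    exact (hil.sup_right him).sup_left (hjl.sup_right hjm)
  have hsub : (x i ∪ x j) ∪ (y l ∪ y m) ⊆ Finset.Icc 1 k :=
    Finset.union_subset (Finset.union_subset (hx i).1 (hx j).1)
      (Finset.union_subset (hy l).1 (hy m).1)
  have hcard := Finset.card_le_card hsub
  rw [Finset.card_union_of_disjoint hdisj, Nat.card_Icc] at hcard
  omega
end

section
/- Let t ≥ 1 and k = 2t + 1, and let x_1,...,x_n and y_1,...,y_n form an isolation set in A_{k,t}. Then for every index i, the number of indices j with x_i ∩ y_j = ∅ is at most 3, and likewise the number of indices j with x_j ∩ y_i = ∅ is at most 3. (That is, every row and every column of the corresponding isolation submatrix has at most three zeros.) -/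
open Finset

/-- A relation that is total on distinct elements of `s` and relates every element of `s` to at
most one other element of `s` forces `s` to have at most three elements. -/
theorem card_le_three_of_total_of_functional {α : Type*} [DecidableEq α] (R : α → α → Prop)
    (s : Finset α) (total : ∀ a ∈ s, ∀ b ∈ s, a ≠ b → R a b ∨ R b a)
    (functional : ∀ a ∈ s, ∀ b ∈ s, ∀ c ∈ s, R a b → R a c → b = c) : s.card ≤ 3 := by
  classical
  have hout : (s.offDiag.filter fun p => R p.1 p.2).card ≤ s.card := by
    refine card_le_card_of_injOn Prod.fst (fun p hp => ?_) ?_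
    · simp_all
    · rintro ⟨a, b⟩ hab ⟨c, d⟩ hcd hac
      simp only [coe_filter, mem_offDiag, Set.mem_ofPred_eq] at hab hcd hac
      subst hac
      rw [functional a hab.1.1 b hab.1.2.1 d hcd.1.2.1 hab.2 hcd.2]
  have hin : (s.offDiag.filter fun p => R p.2 p.1).card ≤ s.card := by
    refine card_le_card_of_injOn Prod.snd (fun p hp => ?_) ?_
    · simp_all
    · rintro ⟨a, b⟩ hab ⟨c, d⟩ hcd hbd
      simp only [coe_filter, mem_offDiag, Set.mem_ofPred_eq] at hab hcd hbd
      subst hbd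
      rw [functional b hab.1.2.1 a hab.1.1 c hcd.1.1 hab.2 hcd.2]
  have hcover : s.offDiag ⊆
      (s.offDiag.filter fun p => R p.1 p.2) ∪ (s.offDiag.filter fun p => R p.2 p.1) := by
    rintro ⟨a, b⟩ hab
    have hab' := mem_offDiag.1 hab
    have := total a hab'.1 b hab'.2.1 hab'.2.2
    simpa [hab'.1, hab'.2.1, hab'.2.2] using this
  have hcard := (card_le_card hcover).trans (card_union_le _ _)
  rw [offDiag_card] at hcard
  by_contra! hlt
  have : 4 * s.card ≤ s.card * s.card := Nat.mul_le_mul_right _ hlt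
  omega

theorem IsIsolationSet.symm {k t n : ℕ} {x y : Fin n → Finset ℕ}
    (h : IsIsolationSet k t n x y) : IsIsolationSet k t n y x := by
  obtain ⟨hx, hy, hdiag, hoff⟩ := h
  refine ⟨hy, hx, fun i => inter_comm (x i) (y i) ▸ hdiag i, fun i j hij => ?_⟩
  rw [inter_comm (y i), inter_comm (y j)]
  exact (hoff i j hij).symm

theorem IsIsolationSet.injective_right {k t n : ℕ} {x y : Fin n → Finset ℕ}
    (h : IsIsolationSet k t n x y) : Function.Injective y := by
  obtain ⟨-, -, hdiag, hoff⟩ := h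
  intro i j hij
  by_contra hne
  rcases hoff i j hne with h0 | h0
  · exact (hij ▸ hdiag i).ne_empty h0
  · exact (hij ▸ hdiag j).ne_empty h0

/-- Two distinct `t`-subsets of a set with `t + 1` elements cover it. -/
theorem union_eq_of_subset_of_card_eq_succ {α : Type*} [DecidableEq α] {t : ℕ} {C u v : Finset α}
    (hC : C.card = t + 1) (hu : u ⊆ C) (hv : v ⊆ C) (hut : u.card = t) (hvt : v.card = t)
    (huv : u ≠ v) : u ∪ v = C := by
  refine eq_of_subset_of_card_le (union_subset hu hv) ?_
  by_contra! hlt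
  have h1 : u = u ∪ v := eq_of_subset_of_card_le subset_union_left (by omega)
  have h2 : v = u ∪ v := eq_of_subset_of_card_le subset_union_right (by omega)
  exact huv (h1.trans h2.symm)

theorem IsIsolationSet.card_row_zeros_le_three {t n : ℕ} {x y : Fin n → Finset ℕ}
    (h : IsIsolationSet (2 * t + 1) t n x y) (i : Fin n) :
    (univ.filter (fun j : Fin n => x i ∩ y j = ∅)).card ≤ 3 := by
  have hinj := h.injective_right
  obtain ⟨hx, hy, hdiag, hoff⟩ := h
  have hC : (Icc 1 (2 * t + 1) \ x i).card = t + 1 := by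
    rw [card_sdiff_of_subset (hx i).1, (hx i).2, Nat.card_Icc]
    omega
  have hsub : ∀ j, x i ∩ y j = ∅ → y j ⊆ Icc 1 (2 * t + 1) \ x i := fun j hj =>
    subset_sdiff.2 ⟨(hy j).1, (disjoint_iff_inter_eq_empty.2 hj).symm⟩
  refine card_le_three_of_total_of_functional (fun a b => x a ∩ y b = ∅) _
    (fun a _ b _ hab => hoff a b hab) fun a ha b hb c hc hab hac => ?_
  simp only [mem_filter, mem_univ, true_and] at ha hb hc
  by_contra hbc
  have hunion := union_eq_of_subset_of_card_eq_succ hC (hsub b hb) (hsub c hc) (hy b).2 (hy c).2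
    (hinj.ne hbc)
  refine (hdiag a).ne_empty (subset_empty.1 ?_)
  calc x a ∩ y a ⊆ x a ∩ (y b ∪ y c) := inter_subset_inter_left (hunion ▸ hsub a ha)
    _ = ∅ := by rw [inter_union_distrib_left, hab, hac, empty_union]

/-- for `t ≥ 1` and `k = 2t + 1`, in an isolation set in
`A_{k,t}` every row and every column of the corresponding isolation submatrix
has at most three zeros. -/
theorem isolation_set_at_most_three_zeros (t k n : ℕ) (ht : 1 ≤ t)
    (hk : k = 2 * t + 1) (x y : Fin n → Finset ℕ)
    (h : IsIsolationSet k t n x y) :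
    ∀ i : Fin n,
      (univ.filter (fun j : Fin n => x i ∩ y j = ∅)).card ≤ 3 ∧
      (univ.filter (fun j : Fin n => x j ∩ y i = ∅)).card ≤ 3 := by
  subst hk
  intro i
  refine ⟨h.card_row_zeros_le_three i, ?_⟩
  simpa only [inter_comm (y i)] using h.symm.card_row_zeros_le_three i
end

section
/- Let E be a relation between two vertex sets V₁ and V₂, each of size 6 (i.e., E ⊆ V₁ × V₂ is the edge set of a bipartite graph), such that every vertex of V₁ is related to exactly 3 vertices of V₂ and every vertex of V₂ is related to exactly 3 vertices of V₁ (the graph is 3-regular). Then the graph contains a 4-cycle: there exist distinct a, a' ∈ V₁ and distinct b, b' ∈ V₂ with (a,b), (a,b'), (a',b), (a',b') all in E. -/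
open Finset

/-- a 3-regular bipartite graph with parts of size 6 contains a
4-cycle: there are distinct `a, a' ∈ V₁` and distinct `b, b' ∈ V₂` such that
all four pairs `(a,b), (a,b'), (a',b), (a',b')` are edges. -/
theorem bipartite_three_regular_has_four_cycle
    (V₁ V₂ : Type*) [Fintype V₁] [Fintype V₂] [DecidableEq V₁] [DecidableEq V₂]
    (h₁ : Fintype.card V₁ = 6) (h₂ : Fintype.card V₂ = 6)
    (E : V₁ → V₂ → Prop) [hE : ∀ a b, Decidable (E a b)]
    (hdeg₁ : ∀ a : V₁, (univ.filter (fun b : V₂ => E a b)).card = 3)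
    (hdeg₂ : ∀ b : V₂, (univ.filter (fun a : V₁ => E a b)).card = 3) :
    ∃ (a a' : V₁) (b b' : V₂), a ≠ a' ∧ b ≠ b' ∧
      E a b ∧ E a b' ∧ E a' b ∧ E a' b' := by
  obtain ⟨a⟩ : Nonempty V₁ := Fintype.card_pos_iff.mp (by omega)
  set N := univ.filter (fun b : V₂ => E a b) with hN
  have hcount : ∑ a' : V₁, (N.filter (fun b => E a' b)).card = 9 := by
    have h := sum_card_bipartiteAbove_eq_sum_card_bipartiteBelow
      (s := (univ : Finset V₁)) (t := N) E
    simp only [bipartiteAbove, bipartiteBelow, hdeg₂, sum_const, hdeg₁ a, hN] at h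
    simpa [hN] using h
  have hself : (N.filter (fun b => E a b)).card ≤ 3 :=
    (card_filter_le _ _).trans (hdeg₁ a).le
  rw [← add_sum_erase univ _ (mem_univ a)] at hcount
  obtain ⟨a', ha', hlt⟩ : ∃ a' ∈ univ.erase a, 1 < (N.filter (fun b => E a' b)).card := by
    by_contra! hle
    have hsum := sum_le_card_nsmul _ _ 1 hle
    simp only [card_erase_of_mem (mem_univ a), card_univ, h₁, smul_eq_mul] at hsum
    omega
  obtain ⟨b, hb, b', hb', hne⟩ := one_lt_card.mp hlt
  simp only [hN, mem_filter, mem_univ, true_and] at hb hb'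
  exact ⟨a, a', b, b', (ne_of_mem_erase ha').symm, hne, hb.1, hb'.1, hb.2, hb'.2⟩
end
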